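/- Dual dispersive embedding into the Bourgain space: for every exponent p > 1 sufficiently close to 1 there exist δ > 0 and c > 0 and a constant C such that for every T ∈ (0,1] and every Schwartz function F(t,x,y) supported in {0 ≤ t ≤ T}, ‖F‖_{X^{−1/2+δ}} ≤ C T^c ‖F‖_{L²(dt)L^{p}(dx)L²(dy)}. Moreover the same bound holds with the norm L²(dt)L^{p}(d(x−y))L²(d(x+y)) on the right-hand side. -/

import Mathlib

open MeasureTheory Complex SchwartzMap
open scoped ENNReal NNReal Real

noncomputable section

/-- 1D Fourier transform with the convention `f̂ ξ = ∫ e^{-iξx} f x dx`. -/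
def FT1 (f : ℝ → ℂ) (ξ : ℝ) : ℂ :=
  ∫ x : ℝ, Complex.exp (-(Complex.I) * (ξ : ℂ) * (x : ℂ)) * f x

/-- 1D inverse Fourier transform. -/
def IFT1 (g : ℝ → ℂ) (x : ℝ) : ℂ :=
  (2 * (Real.pi : ℂ))⁻¹ * ∫ ξ : ℝ, Complex.exp (Complex.I * (ξ : ℂ) * (x : ℂ)) * g ξ

/-- 2D Fourier transform (curried kernels). -/
def FT2 (f : ℝ → ℝ → ℂ) (ξ η : ℝ) : ℂ :=
  ∫ x : ℝ, ∫ y : ℝ, Complex.exp (-(Complex.I) * ((ξ : ℂ) * x + (η : ℂ) * y)) * f x y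

/-- 2D inverse Fourier transform. -/
def IFT2 (g : ℝ → ℝ → ℂ) (x y : ℝ) : ℂ :=
  ((2 * (Real.pi : ℂ)) ^ 2)⁻¹ *
    ∫ ξ : ℝ, ∫ η : ℝ, Complex.exp (Complex.I * ((ξ : ℂ) * x + (η : ℂ) * y)) * g ξ η

/-- Free propagator `e^{it(Δ_x − Δ_y)}`, Fourier multiplier `e^{it(η²−ξ²)}`. -/
def freeGamma (Γ₀ : ℝ → ℝ → ℂ) (t x y : ℝ) : ℂ :=
  IFT2 (fun ξ η => Complex.exp (Complex.I * (t : ℂ) * ((η : ℂ) ^ 2 - (ξ : ℂ) ^ 2)) * FT2 Γ₀ ξ η) x y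

/-- Free propagator `e^{it(Δ_x + Δ_y)}`, Fourier multiplier `e^{−it(ξ²+η²)}`. -/
def freeLambda (Λ₀ : ℝ → ℝ → ℂ) (t x y : ℝ) : ℂ :=
  IFT2 (fun ξ η => Complex.exp (-(Complex.I) * (t : ℂ) * ((ξ : ℂ) ^ 2 + (η : ℂ) ^ 2)) * FT2 Λ₀ ξ η) x y

/-- `|∇_x|^s`, Fourier multiplier `|ξ|^s` in one variable. -/
def absDx (s : ℝ) (f : ℝ → ℂ) (x : ℝ) : ℂ :=
  IFT1 (fun ξ => ((|ξ| ^ s : ℝ) : ℂ) * FT1 f ξ) x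

/-- `|∇_{x,y}|^s`, Fourier multiplier `(ξ²+η²)^{s/2}` on `ℝ²`. -/
def absDxy (s : ℝ) (f : ℝ → ℝ → ℂ) (x y : ℝ) : ℂ :=
  IFT2 (fun ξ η => (((ξ ^ 2 + η ^ 2) ^ (s / 2) : ℝ) : ℂ) * FT2 f ξ η) x y

/-- `|∇_{x+y}|^s`, Fourier multiplier `(|ξ+η|/2)^s` on `ℝ²`. -/
def absDxpy (s : ℝ) (f : ℝ → ℝ → ℂ) (x y : ℝ) : ℂ :=
  IFT2 (fun ξ η => (((|ξ + η| / 2) ^ s : ℝ) : ℂ) * FT2 f ξ η) x y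

/-- `⟨∇_x⟩^s`, Fourier multiplier `(1+ξ²)^{s/2}` in one variable. -/
def japDx (s : ℝ) (f : ℝ → ℂ) (x : ℝ) : ℂ :=
  IFT1 (fun ξ => (((1 + ξ ^ 2) ^ (s / 2) : ℝ) : ℂ) * FT1 f ξ) x

/-- `⟨∇_{x,y}⟩^s`, Fourier multiplier `(1+ξ²+η²)^{s/2}` on `ℝ²`. -/
def japDxy (s : ℝ) (f : ℝ → ℝ → ℂ) (x y : ℝ) : ℂ :=
  IFT2 (fun ξ η => (((1 + ξ ^ 2 + η ^ 2) ^ (s / 2) : ℝ) : ℂ) * FT2 f ξ η) x y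

/-- `L²` norm of a kernel on `ℝ²`. -/
def L2K (f : ℝ → ℝ → ℂ) : ℝ≥0∞ :=
  eLpNorm (fun p : ℝ × ℝ => f p.1 p.2) 2 volume

/-- `L²` norm on `ℝ`. -/
def L2F (f : ℝ → ℂ) : ℝ≥0∞ := eLpNorm f 2 volume

/-- Mixed norm `L^q(μ(dt)) L^r(dx)` for a function of `(t,x)`. -/
def MixedN2 (μ : Measure ℝ) (q r : ℝ≥0∞) (u : ℝ → ℝ → ℂ) : ℝ≥0∞ :=
  eLpNorm (fun t => (eLpNorm (u t) r volume).toReal) q μ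

/-- Mixed norm `L^q(μ(dt)) L^r(dx) L^s(dy)` for a function of `(t,x,y)`. -/
def MixedN3 (μ : Measure ℝ) (q r s : ℝ≥0∞) (u : ℝ → ℝ → ℝ → ℂ) : ℝ≥0∞ :=
  eLpNorm (fun t => (eLpNorm (fun x => (eLpNorm (u t x) s volume).toReal) r volume).toReal) q μ

/-- Spacetime Fourier transform on `ℝ_t × ℝ_x`. -/
def FTtx (u : ℝ → ℝ → ℂ) (τ ξ : ℝ) : ℂ :=
  ∫ t : ℝ, ∫ x : ℝ, Complex.exp (-(Complex.I) * ((τ : ℂ) * t + (ξ : ℂ) * x)) * u t x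

/-- Spacetime Fourier transform on `ℝ_t × ℝ²`. -/
def FTtxy (u : ℝ → ℝ → ℝ → ℂ) (τ ξ η : ℝ) : ℂ :=
  ∫ t : ℝ, ∫ x : ℝ, ∫ y : ℝ,
    Complex.exp (-(Complex.I) * ((τ : ℂ) * t + (ξ : ℂ) * x + (η : ℂ) * y)) * u t x y

/-- Bourgain space norm `X^b` associated to `𝐒 = (1/i)∂_t − Δ_x − Δ_y`. -/
def XbNorm (b : ℝ) (u : ℝ → ℝ → ℝ → ℂ) : ℝ≥0∞ :=
  eLpNorm (fun p : ℝ × ℝ × ℝ =>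
    (((1 + |p.1 + p.2.1 ^ 2 + p.2.2 ^ 2|) ^ b : ℝ) : ℂ) * FTtxy u p.1 p.2.1 p.2.2) 2 volume

/-- Duhamel solution of `𝐒_± Γ = F` with data `Γ₀`. -/
def duhamelGamma (Γ₀ : ℝ → ℝ → ℂ) (F : ℝ → ℝ → ℝ → ℂ) (t x y : ℝ) : ℂ :=
  freeGamma Γ₀ t x y + Complex.I * ∫ s in (0:ℝ)..t, freeGamma (F s) (t - s) x y

/-- Duhamel solution of `𝐒 Λ = F` with data `Λ₀`. -/
def duhamelLambda (Λ₀ : ℝ → ℝ → ℂ) (F : ℝ → ℝ → ℝ → ℂ) (t x y : ℝ) : ℂ :=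
  freeLambda Λ₀ t x y + Complex.I * ∫ s in (0:ℝ)..t, freeLambda (F s) (t - s) x y

/-- The `TT*` bound: a weighted `L²` norm of `θ ↦ ∫ E θ ω h ω` is controlled by the kernel
`∫ W E E*`. -/
lemma lintegral_weight_mul_sq_le {Θ Ω : Type*} [MeasurableSpace Θ] [MeasurableSpace Ω]
    {ν : Measure Θ} {μ : Measure Ω} [SFinite ν] [SFinite μ] {W : Θ → ℝ} (hW : Integrable W ν)
    (hW0 : ∀ θ, 0 ≤ W θ) {E : Θ → Ω → ℂ} (hEm : Measurable (Function.uncurry E))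
    (hE : ∀ θ ω, ‖E θ ω‖ = 1) {h : Ω → ℂ} (hh : Integrable h μ) (k : Ω → Ω → ℝ≥0∞)
    (hk : ∀ ω ω', ‖∫ θ, (W θ : ℂ) * (E θ ω * (starRingEnd ℂ) (E θ ω')) ∂ν‖ₑ ≤ k ω ω') :
    ∫⁻ θ, ENNReal.ofReal (W θ) * ‖∫ ω, E θ ω * h ω ∂μ‖ₑ ^ 2 ∂ν
      ≤ ∫⁻ z : Ω × Ω, k z.1 z.2 * (‖h z.1‖ₑ * ‖h z.2‖ₑ) ∂(μ.prod μ) := by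
  set H : Θ → ℂ := fun θ => ∫ ω, E θ ω * h ω ∂μ with hH
  have hint : Integrable (fun q : Θ × (Ω × Ω) => (W q.1 : ℂ) *
      (E q.1 q.2.1 * (starRingEnd ℂ) (E q.1 q.2.2)) *
        (h q.2.1 * (starRingEnd ℂ) (h q.2.2))) (ν.prod (μ.prod μ)) := by
    have h1 : Integrable (fun q : Θ × (Ω × Ω) => (W q.1 : ℂ) *
        (h q.2.1 * (starRingEnd ℂ) (h q.2.2))) (ν.prod (μ.prod μ)) := by
      have hc : Integrable (fun ω => (starRingEnd ℂ) (h ω)) μ :=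
        (integrable_norm_iff (by
          exact Complex.continuous_conj.comp_aestronglyMeasurable hh.1)).1 (by simpa using hh.norm)
      exact hW.ofReal.mul_prod (hh.mul_prod hc)
    have hm : Measurable (fun q : Θ × (Ω × Ω) => E q.1 q.2.1 * (starRingEnd ℂ) (E q.1 q.2.2)) := by
      have e1 : Measurable (fun q : Θ × (Ω × Ω) => E q.1 q.2.1) :=
        hEm.comp (measurable_fst.prodMk (measurable_fst.comp measurable_snd))
      have e2 : Measurable (fun q : Θ × (Ω × Ω) => E q.1 q.2.2) :=
        hEm.comp (measurable_fst.prodMk (measurable_snd.comp measurable_snd))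
      exact e1.mul (Complex.continuous_conj.measurable.comp e2)
    refine (h1.bdd_mul (c := 1) hm.aestronglyMeasurable (ae_of_all _ fun q => ?_)).congr
      (ae_of_all _ fun q => ?_)
    · simp [hE]
    · simp only; ring
  have hHsq : ∀ θ, ((W θ * ‖H θ‖ ^ 2 : ℝ) : ℂ) = ∫ z : Ω × Ω, (W θ : ℂ) *
      (E θ z.1 * (starRingEnd ℂ) (E θ z.2)) * (h z.1 * (starRingEnd ℂ) (h z.2)) ∂(μ.prod μ) := by
    intro θ
    have e1 : ((W θ * ‖H θ‖ ^ 2 : ℝ) : ℂ) = (W θ : ℂ) * (H θ * (starRingEnd ℂ) (H θ)) := by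
      rw [Complex.mul_conj, Complex.normSq_eq_norm_sq]; push_cast; ring
    rw [e1, hH]
    simp only
    rw [← integral_conj, ← integral_prod_mul, ← integral_const_mul]
    congr 1
    ext z
    simp only [map_mul]
    ring
  have hintR : Integrable (fun θ => W θ * ‖H θ‖ ^ 2) ν := by
    have h2 := hint.integral_prod_left
    simp only at h2
    have h3 : Integrable (fun θ => ((W θ * ‖H θ‖ ^ 2 : ℝ) : ℂ)) ν := by
      simp_rw [hHsq]; exact h2
    exact h3.re.congr (ae_of_all _ fun θ => Complex.ofReal_re _)
  have hnn : ∀ θ, 0 ≤ W θ * ‖H θ‖ ^ 2 := fun θ => mul_nonneg (hW0 θ) (by positivity)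
  calc ∫⁻ θ, ENNReal.ofReal (W θ) * ‖H θ‖ₑ ^ 2 ∂ν
      = ∫⁻ θ, ENNReal.ofReal (W θ * ‖H θ‖ ^ 2) ∂ν := by
        congr 1; ext θ
        rw [ENNReal.ofReal_mul (hW0 θ), ENNReal.ofReal_pow (norm_nonneg _), ofReal_norm]
    _ = ‖∫ θ, ((W θ * ‖H θ‖ ^ 2 : ℝ) : ℂ) ∂ν‖ₑ := by
        rw [← ofReal_integral_eq_lintegral_ofReal hintR (ae_of_all _ hnn), integral_complex_ofReal,
          ← ofReal_norm, Complex.norm_real, Real.norm_of_nonneg (integral_nonneg hnn)]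
    _ = ‖∫ z : Ω × Ω, (∫ θ, (W θ : ℂ) * (E θ z.1 * (starRingEnd ℂ) (E θ z.2)) ∂ν) *
          (h z.1 * (starRingEnd ℂ) (h z.2)) ∂(μ.prod μ)‖ₑ := by
        simp_rw [hHsq]
        rw [integral_integral_swap hint]
        simp_rw [integral_mul_const]
    _ ≤ ∫⁻ z : Ω × Ω, k z.1 z.2 * (‖h z.1‖ₑ * ‖h z.2‖ₑ) ∂(μ.prod μ) := by
        refine (enorm_integral_le_lintegral_enorm _).trans (lintegral_mono fun z => ?_)
        rw [enorm_mul, enorm_mul, RCLike.enorm_conj]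
        gcongr
        exact hk _ _

/-- Removing a Gaussian cutoff by Fatou's lemma. -/
lemma lintegral_le_of_forall_gaussian {Θ : Type*} [MeasurableSpace Θ] {ν : Measure Θ}
    {q : Θ → ℝ} (hq : Measurable q) {G : Θ → ℝ≥0∞} (hG : Measurable G) {M : ℝ≥0∞}
    (h : ∀ ε : ℝ, 0 < ε → ∫⁻ θ, ENNReal.ofReal (Real.exp (-ε * q θ)) * G θ ∂ν ≤ M) :
    ∫⁻ θ, G θ ∂ν ≤ M := by
  have hlim : ∀ θ, Filter.Tendsto
      (fun n : ℕ => ENNReal.ofReal (Real.exp (-(1 / ((n : ℝ) + 1)) * q θ)) * G θ)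
      Filter.atTop (nhds (G θ)) := by
    intro θ
    have h1 : Filter.Tendsto (fun n : ℕ => Real.exp (-(1 / ((n : ℝ) + 1)) * q θ))
        Filter.atTop (nhds 1) := by
      have h0 := (tendsto_one_div_add_atTop_nhds_zero_nat (𝕜 := ℝ)).neg.mul_const (q θ)
      simpa [Function.comp_def] using (Real.continuous_exp.tendsto _).comp h0
    have h2 := ENNReal.Tendsto.mul_const (b := G θ) (ENNReal.tendsto_ofReal h1)
      (Or.inl (by simp))
    simpa using h2
  calc ∫⁻ θ, G θ ∂ν = ∫⁻ θ, Filter.liminf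
        (fun n : ℕ => ENNReal.ofReal (Real.exp (-(1 / ((n : ℝ) + 1)) * q θ)) * G θ)
        Filter.atTop ∂ν := by
        congr 1; ext θ; exact (hlim θ).liminf_eq.symm
    _ ≤ Filter.liminf (fun n : ℕ => ∫⁻ θ,
        ENNReal.ofReal (Real.exp (-(1 / ((n : ℝ) + 1)) * q θ)) * G θ ∂ν) Filter.atTop :=
        lintegral_liminf_le fun n => by fun_prop
    _ ≤ M := by
        refine Filter.liminf_le_of_le (by isBoundedDefault) fun b hb => ?_
        obtain ⟨n, hn⟩ := hb.exists
        exact hn.trans (h _ (by positivity))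

lemma mul_le_half_sq_add_half_sq (a b : ℝ≥0∞) : a * b ≤ 2⁻¹ * a ^ 2 + 2⁻¹ * b ^ 2 := by
  have := ENNReal.young_inequality a b Real.HolderConjugate.two_two
  simpa [ENNReal.div_eq_inv_mul] using this

/-- Schur's test for a convolution kernel. -/
lemma lintegral_conv_mul_le {k N : ℝ → ℝ≥0∞} (hk : Measurable k) (hke : ∀ u, k (-u) = k u)
    (hN : Measurable N) :
    ∫⁻ z : ℝ × ℝ, k (z.1 - z.2) * (N z.1 * N z.2) ≤ (∫⁻ u, k u) * ∫⁻ t, N t ^ 2 := by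
  have hA : ∫⁻ z : ℝ × ℝ, k (z.1 - z.2) * N z.2 ^ 2 = (∫⁻ u, k u) * ∫⁻ t, N t ^ 2 := by
    rw [Measure.volume_eq_prod, lintegral_prod_symm _ (by fun_prop)]
    simp only
    have : ∀ y, ∫⁻ x, k (x - y) * N y ^ 2 = (∫⁻ u, k u) * N y ^ 2 := fun y => by
      rw [lintegral_mul_const _ (by fun_prop), lintegral_sub_right_eq_self (fun x => k x)]
    simp_rw [this]
    rw [lintegral_const_mul _ (by fun_prop)]
  have hB : ∫⁻ z : ℝ × ℝ, k (z.1 - z.2) * N z.1 ^ 2 = (∫⁻ u, k u) * ∫⁻ t, N t ^ 2 := by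
    rw [← hA, Measure.volume_eq_prod, ← lintegral_prod_swap]
    congr 1; ext z
    simp only [Prod.fst_swap, Prod.snd_swap]
    rw [← hke, neg_sub]
  calc ∫⁻ z : ℝ × ℝ, k (z.1 - z.2) * (N z.1 * N z.2)
      ≤ ∫⁻ z : ℝ × ℝ, (2⁻¹ * (k (z.1 - z.2) * N z.1 ^ 2) + 2⁻¹ * (k (z.1 - z.2) * N z.2 ^ 2)) := by
        refine lintegral_mono fun z => ?_
        refine (mul_le_mul_right (mul_le_half_sq_add_half_sq (N z.1) (N z.2)) _).trans
          (le_of_eq ?_)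
        ring
    _ = (∫⁻ u, k u) * ∫⁻ t, N t ^ 2 := by
        rw [lintegral_add_left (by fun_prop), lintegral_const_mul _ (by fun_prop),
          lintegral_const_mul _ (by fun_prop), hA, hB, ← add_mul, ENNReal.inv_two_add_inv_two,
          one_mul]

/-- Cauchy–Schwarz for lower Lebesgue integrals. -/
lemma lintegral_mul_le_sqrt {α : Type*} [MeasurableSpace α] {μ : Measure α} {f g : α → ℝ≥0∞}
    (hf : Measurable f) (hg : Measurable g) :
    ∫⁻ a, f a * g a ∂μ ≤ (∫⁻ a, f a ^ 2 ∂μ) ^ (1 / 2 : ℝ) * (∫⁻ a, g a ^ 2 ∂μ) ^ (1 / 2 : ℝ) := by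
  have := ENNReal.lintegral_mul_le_Lp_mul_Lq μ Real.HolderConjugate.two_two hf.aemeasurable
    hg.aemeasurable
  simpa using this

lemma norm_integral_complex_gaussian_le {b : ℂ} (hb : 0 < b.re) (v : ℝ) :
    ‖∫ x : ℝ, cexp (-b * x ^ 2) * cexp (-I * v * x)‖ ≤ (π / ‖b‖) ^ (1 / 2 : ℝ) := by
  have h := fourierIntegral_gaussian hb (-v)
  have e : ∫ x : ℝ, cexp (-b * x ^ 2) * cexp (-I * v * x) =
      ∫ x : ℝ, cexp (I * (-v) * x) * cexp (-b * x ^ 2) := by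
    congr 1; ext x; rw [mul_comm]; congr 2; ring
  rw [e, h, norm_mul]
  have h1 : ‖((π : ℂ) / b) ^ (1 / 2 : ℂ)‖ = (π / ‖b‖) ^ (1 / 2 : ℝ) := by
    have := Complex.norm_cpow_real ((π : ℂ) / b) (1 / 2)
    push_cast at this
    rw [this, norm_div, Complex.norm_real, Real.norm_of_nonneg Real.pi_pos.le]
  have h2 : ‖cexp (-(-(v : ℂ)) ^ 2 / (4 * b))‖ ≤ 1 := by
    rw [Complex.norm_exp, Real.exp_le_one_iff]
    have : (-(-(v : ℂ)) ^ 2 / (4 * b)) = ((-(v ^ 2 / 4) : ℝ) : ℂ) * b⁻¹ := by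
      push_cast
      rw [neg_sq, div_eq_mul_inv, mul_inv]; ring
    rw [this, Complex.re_ofReal_mul, Complex.inv_re]
    have h3 : 0 ≤ b.re / normSq b := div_nonneg hb.le (normSq_nonneg _)
    nlinarith [sq_nonneg v]
  rw [h1]
  exact mul_le_of_le_one_right (by positivity) h2

lemma norm_integral_real_gaussian {a : ℝ} (ha : 0 < a) (u : ℝ) :
    ‖∫ x : ℝ, cexp (-(a : ℂ) * x ^ 2) * cexp (-I * u * x)‖
      = (π / a) ^ (1 / 2 : ℝ) * Real.exp (-(u ^ 2 / (4 * a))) := by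
  have h := fourierIntegral_gaussian (b := a) (by simpa using ha) (-u)
  have e : ∫ x : ℝ, cexp (-(a : ℂ) * x ^ 2) * cexp (-I * u * x) =
      ∫ x : ℝ, cexp (I * (-u) * x) * cexp (-a * x ^ 2) := by
    congr 1; ext x; rw [mul_comm]; congr 2; ring
  rw [e, h, norm_mul]
  congr 1
  · have := Complex.norm_cpow_real ((π : ℂ) / a) (1 / 2)
    push_cast at this
    rw [this, norm_div, Complex.norm_real, Complex.norm_real, Real.norm_of_nonneg Real.pi_pos.le,
      Real.norm_of_nonneg ha.le]
  · rw [Complex.norm_exp]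
    congr 1
    have : (-(-(u : ℂ)) ^ 2 / (4 * a)) = ((-(u ^ 2 / (4 * a)) : ℝ) : ℂ) := by
      push_cast
      rw [neg_sq]; ring
    rw [this, Complex.ofReal_re]

lemma rpow_le_exp_sq_div {z s : ℝ} (hz : 0 ≤ z) (hs : 0 ≤ s) (hs1 : s ≤ 1) :
    z ^ s ≤ Real.exp (z ^ 2 / 4) := by
  rcases le_total z 1 with h | h
  · exact (Real.rpow_le_one hz h hs).trans (Real.one_le_exp (by positivity))
  · calc z ^ s ≤ z ^ (1 : ℝ) := Real.rpow_le_rpow_of_exponent_le h hs1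
      _ = z := Real.rpow_one z
      _ ≤ z ^ 2 / 4 + 1 := by nlinarith [sq_nonneg (z - 2)]
      _ ≤ _ := Real.add_one_le_exp _

/-- The time kernel `π r³ |u|^{-3/4}` that dominates every kernel produced by `TT*` at modulation
scale `r⁴`. -/
def timeKernel (r u : ℝ) : ℝ≥0∞ := ENNReal.ofReal (π * r ^ 3) * ‖u‖ₑ ^ (-(3 / 4) : ℝ)

lemma measurable_timeKernel (r : ℝ) : Measurable (timeKernel r) := by
  unfold timeKernel; fun_prop

lemma timeKernel_neg (r u : ℝ) : timeKernel r (-u) = timeKernel r u := by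
  simp [timeKernel]

lemma timeKernel_zero {r : ℝ} (hr : 0 < r) : timeKernel r 0 = ⊤ := by
  unfold timeKernel
  rw [enorm_zero, ENNReal.zero_rpow_of_neg (by norm_num), ENNReal.mul_top]
  simpa using by positivity

lemma timeKernel_of_ne {r u : ℝ} (hr : 0 < r) (hu : u ≠ 0) :
    timeKernel r u = ENNReal.ofReal (π * r ^ 3 * |u| ^ (-(3 / 4) : ℝ)) := by
  unfold timeKernel
  rw [ENNReal.ofReal_mul (p := π * r ^ 3) (by positivity), ← ofReal_norm, Real.norm_eq_abs,
    ENNReal.ofReal_rpow_of_pos (abs_pos.2 hu)]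

lemma exp_neg_scale_le {r u s : ℝ} (hr : 0 < r) (hu : u ≠ 0) (hs : 0 ≤ s) (hs1 : s ≤ 1) :
    Real.exp (-(u ^ 2 / (4 * (r ^ 8)⁻¹))) ≤ (r ^ 4 * |u|) ^ (-s) := by
  have hu' := abs_pos.2 hu
  have h := rpow_le_exp_sq_div (z := r ^ 4 * |u|) (by positivity) hs hs1
  rw [Real.rpow_neg (by positivity), Real.exp_neg]
  have e : u ^ 2 / (4 * (r ^ 8)⁻¹) = (r ^ 4 * |u|) ^ 2 / 4 := by
    rw [mul_pow, sq_abs]; field_simp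
  rw [e]
  gcongr

lemma rpow_half_pi_div {r : ℝ} (hr : 0 < r) :
    (π / (r ^ 8)⁻¹) ^ (1 / 2 : ℝ) = π ^ (1 / 2 : ℝ) * r ^ 4 := by
  rw [div_inv_eq_mul, Real.mul_rpow Real.pi_pos.le (by positivity)]
  congr 1
  rw [show r ^ 8 = (r ^ 4) ^ (2 : ℝ) by rw [Real.rpow_two]; ring, ← Real.rpow_mul (by positivity)]
  norm_num

lemma gaussian_le_timeKernel {r : ℝ} (hr : 1 ≤ r) (u : ℝ) :
    ENNReal.ofReal ((π / (r ^ 8)⁻¹) ^ (1 / 2 : ℝ) * Real.exp (-(u ^ 2 / (4 * (r ^ 8)⁻¹))))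
      ≤ timeKernel r u := by
  have hr0 : 0 < r := by linarith
  rcases eq_or_ne u 0 with rfl | hu
  · rw [timeKernel_zero hr0]; exact le_top
  have hu' := abs_pos.2 hu
  rw [timeKernel_of_ne hr0 hu, rpow_half_pi_div hr0]
  refine ENNReal.ofReal_le_ofReal ?_
  have h := exp_neg_scale_le hr0 hu (s := 3 / 4) (by norm_num) (by norm_num)
  rw [Real.mul_rpow (by positivity) hu'.le] at h
  have e : (r ^ 4) ^ (-(3 / 4) : ℝ) = (r ^ 3)⁻¹ := by
    rw [← Real.rpow_natCast, ← Real.rpow_mul hr0.le, ← Real.rpow_natCast, ← Real.rpow_neg hr0.le]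
    norm_num
  rw [e] at h
  have hpi : π ^ (1 / 2 : ℝ) ≤ π := by
    have := Real.rpow_le_rpow_of_exponent_le (x := π) (y := 1 / 2) (z := 1)
      (by linarith [Real.pi_gt_three]) (by norm_num)
    simpa using this
  calc _ ≤ π ^ (1 / 2 : ℝ) * r ^ 4 * ((r ^ 3)⁻¹ * |u| ^ (-(3 / 4) : ℝ)) := by gcongr
    _ = π ^ (1 / 2 : ℝ) * r * |u| ^ (-(3 / 4) : ℝ) := by field_simp
    _ ≤ π * r ^ 3 * |u| ^ (-(3 / 4) : ℝ) := by
      gcongr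
      exact le_self_pow₀ hr (by norm_num)

lemma gaussian_mul_dispersion_le_timeKernel {r : ℝ} (hr : 0 < r) (u : ℝ) {d : ℝ}
    (hd : |u| ≤ d) :
    ENNReal.ofReal ((π / (r ^ 8)⁻¹) ^ (1 / 2 : ℝ) * Real.exp (-(u ^ 2 / (4 * (r ^ 8)⁻¹))) *
      (π / d) ^ (1 / 2 : ℝ)) ≤ timeKernel r u := by
  rcases eq_or_ne u 0 with rfl | hu
  · rw [timeKernel_zero hr]; exact le_top
  have hu' := abs_pos.2 hu
  have hd' : 0 < d := hu'.trans_le hd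
  rw [timeKernel_of_ne hr hu, rpow_half_pi_div hr]
  refine ENNReal.ofReal_le_ofReal ?_
  have h := exp_neg_scale_le hr hu (s := 1 / 4) (by norm_num) (by norm_num)
  rw [Real.mul_rpow (by positivity) hu'.le] at h
  have e : (r ^ 4) ^ (-(1 / 4) : ℝ) = r⁻¹ := by
    rw [← Real.rpow_natCast, ← Real.rpow_mul hr.le, ← Real.rpow_neg_one]
    norm_num
  rw [e] at h
  have h2 : (π / d) ^ (1 / 2 : ℝ) ≤ π ^ (1 / 2 : ℝ) * |u| ^ (-(1 / 2) : ℝ) := by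
    rw [Real.rpow_neg hu'.le, ← div_eq_mul_inv, ← Real.div_rpow Real.pi_pos.le hu'.le]
    gcongr
  have hpi : π ^ (1 / 2 : ℝ) * π ^ (1 / 2 : ℝ) = π := by
    rw [← Real.rpow_add Real.pi_pos]; norm_num
  have hu2 : |u| ^ (-(1 / 4) : ℝ) * |u| ^ (-(1 / 2) : ℝ) = |u| ^ (-(3 / 4) : ℝ) := by
    rw [← Real.rpow_add hu']; norm_num
  calc _ ≤ π ^ (1 / 2 : ℝ) * r ^ 4 * (r⁻¹ * |u| ^ (-(1 / 4) : ℝ)) *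
        (π ^ (1 / 2 : ℝ) * |u| ^ (-(1 / 2) : ℝ)) := by gcongr
    _ = (π ^ (1 / 2 : ℝ) * π ^ (1 / 2 : ℝ)) * r ^ 3 *
        (|u| ^ (-(1 / 4) : ℝ) * |u| ^ (-(1 / 2) : ℝ)) := by field_simp
    _ = _ := by rw [hpi, hu2]

lemma norm_exp_neg_I_mul (θ : ℝ) : ‖cexp (-I * θ)‖ = 1 := by
  rw [show -I * (θ : ℂ) = ((-θ : ℝ) : ℂ) * I by push_cast; ring, Complex.norm_exp_ofReal_mul_I]

lemma exp_neg_I_mul_conj (θ θ' : ℝ) :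
    cexp (-I * θ) * (starRingEnd ℂ) (cexp (-I * θ')) = cexp (-I * ((θ - θ' : ℝ) : ℂ)) := by
  rw [← Complex.exp_conj, ← Complex.exp_add]
  congr 1
  simp only [map_mul, map_neg, Complex.conj_I, Complex.conj_ofReal]
  push_cast; ring

lemma integral_shifted_gaussian {a : ℝ} (u c : ℝ) :
    ∫ τ : ℝ, ((Real.exp (-a * (τ + c) ^ 2) : ℝ) : ℂ) * cexp (-I * ((τ * u : ℝ) : ℂ))
      = cexp (I * ((c * u : ℝ) : ℂ)) * ∫ τ : ℝ, cexp (-(a : ℂ) * τ ^ 2) * cexp (-I * u * τ) := by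
  rw [← integral_const_mul]
  rw [← integral_add_right_eq_self (fun τ : ℝ => cexp (I * ((c * u : ℝ) : ℂ)) *
    (cexp (-(a : ℂ) * τ ^ 2) * cexp (-I * u * τ))) c]
  congr 1; ext τ
  push_cast
  simp only [← Complex.exp_add]
  congr 1
  ring

lemma norm_exp_I_mul (θ : ℝ) : ‖cexp (I * θ)‖ = 1 := by
  rw [mul_comm, Complex.norm_exp_ofReal_mul_I]

/-- The weighted `L²` norm of a Fourier transform against a Gaussian weight. -/
lemma lintegral_gaussian_mul_FT1_sq_le {a : ℝ} (ha : 0 < a) (c : ℝ) {h : ℝ → ℂ}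
    (hh : Integrable h) :
    ∫⁻ τ : ℝ, ENNReal.ofReal (Real.exp (-a * (τ + c) ^ 2)) * ‖FT1 h τ‖ₑ ^ 2
      ≤ ∫⁻ z : ℝ × ℝ, ENNReal.ofReal ((π / a) ^ (1 / 2 : ℝ) *
          Real.exp (-((z.1 - z.2) ^ 2 / (4 * a)))) * (‖h z.1‖ₑ * ‖h z.2‖ₑ) := by
  have hW : Integrable (fun τ : ℝ => Real.exp (-a * (τ + c) ^ 2)) :=
    (integrable_exp_neg_mul_sq ha).comp_add_right c
  have := lintegral_weight_mul_sq_le (ν := volume) (μ := volume) hW (fun _ => (Real.exp_pos _).le)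
    (E := fun τ t : ℝ => cexp (-I * ((τ * t : ℝ) : ℂ)))
    (by unfold Function.uncurry; fun_prop) (fun _ _ => norm_exp_neg_I_mul _) hh
    (fun t t' => ENNReal.ofReal ((π / a) ^ (1 / 2 : ℝ) * Real.exp (-((t - t') ^ 2 / (4 * a)))))
    (fun t t' => by
      simp_rw [exp_neg_I_mul_conj, ← mul_sub]
      rw [integral_shifted_gaussian, enorm_mul, ← ofReal_norm, ← ofReal_norm, norm_exp_I_mul,
        norm_integral_real_gaussian ha]
      simp)
  refine le_trans (le_of_eq ?_) this
  congr 1; ext τ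
  congr 3
  unfold FT1
  congr 1; ext t
  push_cast
  congr 2; ring

lemma measurable_FT1_uncurry {α : Type*} [MeasurableSpace α] {f : α → ℝ → ℂ}
    (hf : Measurable (Function.uncurry f)) :
    Measurable (fun q : α × ℝ => FT1 (f q.1) q.2) := by
  have h : Measurable (fun w : (α × ℝ) × ℝ =>
      cexp (-I * (w.1.2 : ℂ) * (w.2 : ℂ)) * f w.1.1 w.2) := by
    have : Measurable (fun w : (α × ℝ) × ℝ => f w.1.1 w.2) :=
      hf.comp ((measurable_fst.comp measurable_fst).prodMk measurable_snd)
    fun_prop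
  exact (h.stronglyMeasurable.integral_prod_right (ν := volume)).measurable

lemma measurable_FT1 {h : ℝ → ℂ} (hm : Measurable h) : Measurable (FT1 h) := by
  have h : Measurable (fun w : ℝ × ℝ => cexp (-I * (w.1 : ℂ) * (w.2 : ℂ)) * h w.2) := by
    fun_prop
  exact (h.stronglyMeasurable.integral_prod_right (ν := volume)).measurable

/-- Bessel's inequality for the Fourier transform. -/
lemma lintegral_FT1_sq_le {h : ℝ → ℂ} (hm : Measurable h) (hh : Integrable h) :
    ∫⁻ τ : ℝ, ‖FT1 h τ‖ₑ ^ 2 ≤ ENNReal.ofReal (2 * π) * ∫⁻ t, ‖h t‖ₑ ^ 2 := by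
  refine lintegral_le_of_forall_gaussian (q := fun τ => τ ^ 2) (by fun_prop)
    ((measurable_FT1 hm).enorm.pow_const 2) fun a ha => ?_
  have h1 := lintegral_gaussian_mul_FT1_sq_le ha 0 hh
  simp only [add_zero] at h1
  refine h1.trans ((lintegral_conv_mul_le (N := fun t => ‖h t‖ₑ)
    (k := fun u => ENNReal.ofReal ((π / a) ^ (1 / 2 : ℝ) * Real.exp (-(u ^ 2 / (4 * a)))))
    (by fun_prop) (fun u => by simp) (by fun_prop)).trans (le_of_eq ?_))
  congr 1
  have e : ∀ u : ℝ, -(u ^ 2 / (4 * a)) = -(4 * a)⁻¹ * u ^ 2 := fun u => by ring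
  simp_rw [e]
  rw [← ofReal_integral_eq_lintegral_ofReal
    ((integrable_exp_neg_mul_sq (b := (4 * a)⁻¹) (by positivity)).const_mul _)
    (ae_of_all _ fun u => by positivity), integral_const_mul, integral_gaussian]
  congr 1
  rw [← Real.sqrt_eq_rpow, ← Real.sqrt_mul (by positivity)]
  rw [show π / a * (π / (4 * a)⁻¹) = (2 * π) ^ 2 by field_simp; ring]
  exact Real.sqrt_sq (by positivity)

lemma integrable_paraboloid_weight {a ε κ c : ℝ} (ha : 0 < a) (hε : 0 < ε) :
    Integrable (fun θ : ℝ × ℝ =>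
      Real.exp (-ε * θ.1 ^ 2) * Real.exp (-a * (θ.2 + (κ * θ.1 ^ 2 + c)) ^ 2)) := by
  rw [Measure.volume_eq_prod, integrable_prod_iff (by fun_prop)]
  refine ⟨ae_of_all _ fun ξ => ?_, ?_⟩
  · exact ((integrable_exp_neg_mul_sq ha).comp_add_right (κ * ξ ^ 2 + c)).const_mul
      (Real.exp (-ε * ξ ^ 2))
  · have e : ∀ ξ : ℝ, ∫ τ : ℝ, ‖Real.exp (-ε * ξ ^ 2) *
        Real.exp (-a * (τ + (κ * ξ ^ 2 + c)) ^ 2)‖ = Real.exp (-ε * ξ ^ 2) * √(π / a) := by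
      intro ξ
      have : ∀ τ : ℝ, ‖Real.exp (-ε * ξ ^ 2) * Real.exp (-a * (τ + (κ * ξ ^ 2 + c)) ^ 2)‖
          = Real.exp (-ε * ξ ^ 2) * Real.exp (-a * (τ + (κ * ξ ^ 2 + c)) ^ 2) := fun τ =>
        Real.norm_of_nonneg (by positivity)
      simp_rw [this]
      rw [integral_const_mul, integral_add_right_eq_self (fun τ => Real.exp (-a * τ ^ 2)),
        integral_gaussian]
    simp only [e]
    exact (integrable_exp_neg_mul_sq hε).mul_const _

/-- The one-dimensional dispersive estimate for a Gaussian-regularised paraboloid. -/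
lemma enorm_paraboloid_kernel_le {r ε κ c : ℝ} (hr : 0 < r) (hε : 0 < ε) (hκ : 1 ≤ κ)
    (ω ω' : ℝ × ℝ) :
    ‖∫ θ : ℝ × ℝ, ((Real.exp (-ε * θ.1 ^ 2) *
        Real.exp (-(r ^ 8)⁻¹ * (θ.2 + (κ * θ.1 ^ 2 + c)) ^ 2) : ℝ) : ℂ) *
      (cexp (-I * ((θ.2 * ω.1 + θ.1 * ω.2 : ℝ) : ℂ)) *
        (starRingEnd ℂ) (cexp (-I * ((θ.2 * ω'.1 + θ.1 * ω'.2 : ℝ) : ℂ))))‖ₑ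
      ≤ timeKernel r (ω.1 - ω'.1) := by
  set u := ω.1 - ω'.1 with hu
  set v := ω.2 - ω'.2 with hv
  set a := (r ^ 8)⁻¹ with ha
  have ha0 : 0 < a := by positivity
  have hint := integrable_paraboloid_weight (κ := κ) (c := c) ha0 hε
  simp_rw [exp_neg_I_mul_conj]
  have e0 : ∀ θ : ℝ × ℝ, θ.2 * ω.1 + θ.1 * ω.2 - (θ.2 * ω'.1 + θ.1 * ω'.2)
      = θ.2 * u + θ.1 * v := fun θ => by rw [hu, hv]; ring
  simp_rw [e0]
  rw [Measure.volume_eq_prod, integral_prod]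
  swap
  · rw [← Measure.volume_eq_prod]
    refine (hint.ofReal (𝕜 := ℂ)).mul_bdd (c := 1) (by fun_prop)
      (ae_of_all _ fun θ => (norm_exp_neg_I_mul _).le)
  have e1 : ∀ ξ : ℝ, ∫ τ : ℝ, ((Real.exp (-ε * ξ ^ 2) *
        Real.exp (-a * (τ + (κ * ξ ^ 2 + c)) ^ 2) : ℝ) : ℂ) *
        cexp (-I * ((τ * u + ξ * v : ℝ) : ℂ))
      = (∫ τ : ℝ, cexp (-(a : ℂ) * τ ^ 2) * cexp (-I * u * τ)) * cexp (I * ((c * u : ℝ) : ℂ)) *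
        (cexp (-((ε : ℂ) - I * ((κ * u : ℝ) : ℂ)) * ξ ^ 2) * cexp (-I * v * ξ)) := by
    intro ξ
    have e2 : ∀ τ : ℝ, ((Real.exp (-ε * ξ ^ 2) *
        Real.exp (-a * (τ + (κ * ξ ^ 2 + c)) ^ 2) : ℝ) : ℂ) *
        cexp (-I * ((τ * u + ξ * v : ℝ) : ℂ)) = (cexp (-ε * ξ ^ 2) * cexp (-I * v * ξ)) *
        (((Real.exp (-a * (τ + (κ * ξ ^ 2 + c)) ^ 2) : ℝ) : ℂ) *
          cexp (-I * ((τ * u : ℝ) : ℂ))) := by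
      intro τ
      push_cast
      simp only [← Complex.exp_add]
      congr 1; ring
    simp_rw [e2]
    rw [integral_const_mul, integral_shifted_gaussian]
    have e3 : cexp (-ε * ξ ^ 2) * cexp (-I * v * ξ) * cexp (I * (((κ * ξ ^ 2 + c) * u : ℝ) : ℂ))
        = cexp (I * ((c * u : ℝ) : ℂ)) *
        (cexp (-((ε : ℂ) - I * ((κ * u : ℝ) : ℂ)) * ξ ^ 2) * cexp (-I * v * ξ)) := by
      push_cast
      simp only [← Complex.exp_add]
      congr 1; ring
    rw [← mul_assoc, e3]; ring
  simp only [e1]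
  rw [integral_const_mul, ← ofReal_norm, norm_mul, norm_mul, norm_exp_I_mul, mul_one,
    norm_integral_real_gaussian ha0]
  have hb : 0 < ((ε : ℂ) - I * ((κ * u : ℝ) : ℂ)).re := by simpa using hε
  have hb2 : |u| ≤ ‖(ε : ℂ) - I * ((κ * u : ℝ) : ℂ)‖ := by
    refine le_trans ?_ (Complex.abs_im_le_norm _)
    simp only [Complex.sub_im, Complex.ofReal_im, Complex.mul_im, Complex.I_re, Complex.I_im,
      Complex.ofReal_re, zero_mul, one_mul, zero_add, zero_sub, abs_neg, abs_mul]
    rw [abs_of_pos (by linarith : 0 < κ)]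
    exact le_mul_of_one_le_left (abs_nonneg _) hκ
  refine le_trans (ENNReal.ofReal_le_ofReal ?_) (gaussian_mul_dispersion_le_timeKernel hr u hb2)
  gcongr
  exact norm_integral_complex_gaussian_le hb v

lemma measurable_plane_fourier {g : ℝ × ℝ → ℂ} (hm : Measurable g) :
    Measurable (fun θ : ℝ × ℝ => ∫ ω : ℝ × ℝ,
      cexp (-I * ((θ.2 * ω.1 + θ.1 * ω.2 : ℝ) : ℂ)) * g ω) := by
  have h : Measurable (fun w : (ℝ × ℝ) × (ℝ × ℝ) =>
      cexp (-I * ((w.1.2 * w.2.1 + w.1.1 * w.2.2 : ℝ) : ℂ)) * g w.2) := by fun_prop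
  exact (h.stronglyMeasurable.integral_prod_right (ν := volume)).measurable

lemma lintegral_paraboloid_sq_le {r κ : ℝ} (c : ℝ) (hr : 0 < r) (hκ : 1 ≤ κ)
    {g : ℝ × ℝ → ℂ} (hm : Measurable g) (hg : Integrable g) :
    ∫⁻ θ : ℝ × ℝ, ENNReal.ofReal (Real.exp (-(r ^ 8)⁻¹ * (θ.2 + (κ * θ.1 ^ 2 + c)) ^ 2)) *
        ‖∫ ω : ℝ × ℝ, cexp (-I * ((θ.2 * ω.1 + θ.1 * ω.2 : ℝ) : ℂ)) * g ω‖ₑ ^ 2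
      ≤ ∫⁻ z : (ℝ × ℝ) × (ℝ × ℝ),
          timeKernel r (z.1.1 - z.2.1) * (‖g z.1‖ₑ * ‖g z.2‖ₑ) := by
  refine lintegral_le_of_forall_gaussian (q := fun θ => θ.1 ^ 2) (by fun_prop)
    (Measurable.mul (by fun_prop) ((measurable_plane_fourier hm).enorm.pow_const 2))
    fun ε hε => ?_
  have := lintegral_weight_mul_sq_le (ν := volume) (μ := volume)
    (integrable_paraboloid_weight (a := (r ^ 8)⁻¹) (κ := κ) (c := c) (by positivity) hε)
    (fun _ => by positivity)
    (E := fun θ ω : ℝ × ℝ => cexp (-I * ((θ.2 * ω.1 + θ.1 * ω.2 : ℝ) : ℂ)))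
    (by unfold Function.uncurry; fun_prop) (fun _ _ => norm_exp_neg_I_mul _) hg
    (fun ω ω' => timeKernel r (ω.1 - ω'.1)) (fun ω ω' => enorm_paraboloid_kernel_le hr hε hκ ω ω')
  refine le_trans (le_of_eq ?_) this
  congr 1; ext θ
  rw [ENNReal.ofReal_mul (Real.exp_pos _).le, mul_assoc]
  rfl

lemma lintegral_mul_le_of_sq_le {α : Type*} [MeasurableSpace α] {μ : Measure α} {f g : α → ℝ≥0∞}
    (hf : Measurable f) (hg : Measurable g) {c X Y : ℝ≥0∞} (hX : ∫⁻ a, f a ^ 2 ∂μ ≤ c * X)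
    (hY : ∫⁻ a, g a ^ 2 ∂μ ≤ c * Y) :
    ∫⁻ a, f a * g a ∂μ ≤ c * (X ^ (1 / 2 : ℝ) * Y ^ (1 / 2 : ℝ)) := by
  have hc : c ^ (1 / 2 : ℝ) * c ^ (1 / 2 : ℝ) = c := by
    rw [← ENNReal.rpow_add_of_nonneg _ _ (by norm_num) (by norm_num)]; norm_num
  calc ∫⁻ a, f a * g a ∂μ ≤ (c * X) ^ (1 / 2 : ℝ) * (c * Y) ^ (1 / 2 : ℝ) :=
        (lintegral_mul_le_sqrt hf hg).trans (by gcongr)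
    _ = (c ^ (1 / 2 : ℝ) * c ^ (1 / 2 : ℝ)) * (X ^ (1 / 2 : ℝ) * Y ^ (1 / 2 : ℝ)) := by
        rw [ENNReal.mul_rpow_of_nonneg _ _ (by norm_num),
          ENNReal.mul_rpow_of_nonneg _ _ (by norm_num)]
        ring
    _ = _ := by rw [hc]

/-- The integrable profile `(1 + x²)⁻¹`. -/
def quadDecay (x : ℝ) : ℝ := (1 + x ^ 2)⁻¹

lemma quadDecay_pos (x : ℝ) : 0 < quadDecay x := by unfold quadDecay; positivity

lemma quadDecay_le_one (x : ℝ) : quadDecay x ≤ 1 := by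
  unfold quadDecay
  exact inv_le_one_of_one_le₀ (by nlinarith [sq_nonneg x])

lemma integrable_quadDecay : Integrable quadDecay := integrable_inv_one_add_sq

lemma integral_quadDecay_nonneg : 0 ≤ ∫ x, quadDecay x :=
  integral_nonneg fun x => (quadDecay_pos x).le

/-- Jointly measurable functions of `(t, x, y)` with quadratic decay in each variable. -/
structure HasDecay (f : ℝ → ℝ → ℝ → ℂ) : Prop where
  meas : Measurable (fun q : ℝ × ℝ × ℝ => f q.1 q.2.1 q.2.2)
  bound : ∃ A : ℝ, 0 ≤ A ∧ ∀ t x y, ‖f t x y‖ ≤ A * (quadDecay t * quadDecay x * quadDecay y)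

lemma norm_FT1_le_of_bound {h : ℝ → ℂ} {B : ℝ} (hb : ∀ x, ‖h x‖ ≤ B * quadDecay x) (ξ : ℝ) :
    ‖FT1 h ξ‖ ≤ B * ∫ x, quadDecay x := by
  rw [← integral_const_mul]
  refine norm_integral_le_of_norm_le (integrable_quadDecay.const_mul B) (ae_of_all _ fun x => ?_)
  rw [norm_mul, show -I * (ξ : ℂ) * (x : ℂ) = -I * ((ξ * x : ℝ) : ℂ) by push_cast; ring,
    norm_exp_neg_I_mul, one_mul]
  exact hb x

lemma integrable_of_decay_bound {h : ℝ → ℂ} (hm : Measurable h) {B : ℝ}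
    (hb : ∀ x, ‖h x‖ ≤ B * quadDecay x) : Integrable h :=
  (integrable_quadDecay.const_mul B).mono' hm.aestronglyMeasurable (ae_of_all _ hb)

namespace HasDecay

variable {f : ℝ → ℝ → ℝ → ℂ}

lemma measurable_slice (hf : HasDecay f) (t x : ℝ) : Measurable (f t x) :=
  hf.meas.comp (measurable_const.prodMk (measurable_const.prodMk measurable_id))

lemma integrable_slice (hf : HasDecay f) (t x : ℝ) : Integrable (f t x) := by
  obtain ⟨A, -, hA⟩ := hf.bound
  exact integrable_of_decay_bound (hf.measurable_slice t x) (B := A * (quadDecay t * quadDecay x))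
    fun y => (hA t x y).trans_eq (by ring)

lemma measurable_FTy (hf : HasDecay f) :
    Measurable (fun q : (ℝ × ℝ) × ℝ => FT1 (f q.1.1 q.1.2) q.2) :=
  measurable_FT1_uncurry (f := fun (ω : ℝ × ℝ) y => f ω.1 ω.2 y)
    (hf.meas.comp ((measurable_fst.comp measurable_fst).prodMk
      ((measurable_snd.comp measurable_fst).prodMk measurable_snd)))

lemma bound_FTy (hf : HasDecay f) :
    ∃ A : ℝ, 0 ≤ A ∧ ∀ t x η, ‖FT1 (f t x) η‖ ≤ A * (quadDecay t * quadDecay x) := by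
  obtain ⟨A, hA0, hA⟩ := hf.bound
  refine ⟨A * ∫ x, quadDecay x, mul_nonneg hA0 integral_quadDecay_nonneg, fun t x η => ?_⟩
  refine (norm_FT1_le_of_bound (B := A * (quadDecay t * quadDecay x))
    (fun y => (hA t x y).trans_eq (by ring)) η).trans_eq (by ring)

lemma measurable_FTy_slice (hf : HasDecay f) (η : ℝ) :
    Measurable (fun ω : ℝ × ℝ => FT1 (f ω.1 ω.2) η) :=
  hf.measurable_FTy.comp (f := fun ω : ℝ × ℝ => (ω, η)) (by fun_prop)

lemma integrable_FTy (hf : HasDecay f) (η : ℝ) :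
    Integrable (fun ω : ℝ × ℝ => FT1 (f ω.1 ω.2) η) := by
  obtain ⟨A, -, hA⟩ := hf.bound_FTy
  exact ((integrable_quadDecay.mul_prod integrable_quadDecay).const_mul A).mono'
    (hf.measurable_FTy_slice η).aestronglyMeasurable (ae_of_all _ fun ω => hA ω.1 ω.2 η)

lemma measurable_FTxy (hf : HasDecay f) :
    Measurable (fun q : (ℝ × ℝ) × ℝ => FT1 (fun x => FT1 (f q.1.1 x) q.1.2) q.2) :=
  measurable_FT1_uncurry (f := fun (w : ℝ × ℝ) x => FT1 (f w.1 x) w.2)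
    (hf.measurable_FTy.comp (f := fun q : (ℝ × ℝ) × ℝ => ((q.1.1, q.2), q.1.2)) (by fun_prop))

lemma bound_FTxy (hf : HasDecay f) :
    ∃ A : ℝ, 0 ≤ A ∧ ∀ t ξ η, ‖FT1 (fun x => FT1 (f t x) η) ξ‖ ≤ A * quadDecay t := by
  obtain ⟨A, hA0, hA⟩ := hf.bound_FTy
  refine ⟨A * ∫ x, quadDecay x, mul_nonneg hA0 integral_quadDecay_nonneg, fun t ξ η => ?_⟩
  refine (norm_FT1_le_of_bound (B := A * quadDecay t)
    (fun x => (hA t x η).trans_eq (by ring)) ξ).trans_eq (by ring)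

lemma integrable_FTxy (hf : HasDecay f) (ξ η : ℝ) :
    Integrable (fun t => FT1 (fun x => FT1 (f t x) η) ξ) := by
  obtain ⟨A, -, hA⟩ := hf.bound_FTxy
  exact integrable_of_decay_bound (hf.measurable_FTxy.comp
    (f := fun t : ℝ => ((t, η), ξ)) (by fun_prop)) (fun t => hA t ξ η)

end HasDecay

lemma FTtxy_eq_iterate (f : ℝ → ℝ → ℝ → ℂ) (τ ξ η : ℝ) :
    FTtxy f τ ξ η = FT1 (fun t => FT1 (fun x => FT1 (f t x) η) ξ) τ := by
  unfold FTtxy FT1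
  simp_rw [← integral_const_mul, ← mul_assoc, ← Complex.exp_add]
  congr 1; ext t; congr 1; ext x; congr 1; ext y
  congr 2; ring

namespace HasDecay

variable {f : ℝ → ℝ → ℝ → ℂ}

lemma FTtxy_eq_plane (hf : HasDecay f) (τ ξ η : ℝ) :
    FTtxy f τ ξ η = ∫ ω : ℝ × ℝ, cexp (-I * ((τ * ω.1 + ξ * ω.2 : ℝ) : ℂ)) *
      FT1 (f ω.1 ω.2) η := by
  rw [Measure.volume_eq_prod, integral_prod]
  · rw [FTtxy_eq_iterate]
    unfold FT1
    simp_rw [← integral_const_mul, ← mul_assoc, ← Complex.exp_add]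
    congr 1; ext t; congr 1; ext x; congr 1; ext y
    congr 2; push_cast; ring
  · exact (hf.integrable_FTy η).bdd_mul (c := 1) (by fun_prop)
      (ae_of_all _ fun ω => (norm_exp_neg_I_mul _).le)

lemma measurable_FTtxy (hf : HasDecay f) :
    Measurable (fun p : ℝ × ℝ × ℝ => FTtxy f p.1 p.2.1 p.2.2) := by
  simp_rw [FTtxy_eq_iterate]
  have h := measurable_FT1_uncurry (f := fun (w : ℝ × ℝ) t => FT1 (fun x => FT1 (f t x) w.2) w.1)
    (hf.measurable_FTxy.comp (f := fun q : (ℝ × ℝ) × ℝ => ((q.2, q.1.2), q.1.1)) (by fun_prop))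
  exact h.comp (f := fun p : ℝ × ℝ × ℝ => (p.2, p.1)) (by fun_prop)

end HasDecay

/-- The `L²(dy)` norm of a slice. -/
def sliceNorm (f : ℝ → ℝ → ℝ → ℂ) (t x : ℝ) : ℝ≥0∞ := (∫⁻ y, ‖f t x y‖ₑ ^ 2) ^ (1 / 2 : ℝ)

/-- The part of the spacetime `L²` norm of `FTtxy f` at distance `≲ r⁴` from the paraboloid
`τ + κ(ξ² + η²) = 0`. -/
def modulationEnergy (r κ : ℝ) (f : ℝ → ℝ → ℝ → ℂ) : ℝ≥0∞ :=
  ∫⁻ p : ℝ × ℝ × ℝ,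
    ENNReal.ofReal (Real.exp (-(r ^ 8)⁻¹ * (p.1 + κ * (p.2.1 ^ 2 + p.2.2 ^ 2)) ^ 2)) *
      ‖FTtxy f p.1 p.2.1 p.2.2‖ₑ ^ 2

lemma sliceNorm_sq (f : ℝ → ℝ → ℝ → ℂ) (t x : ℝ) :
    sliceNorm f t x ^ 2 = ∫⁻ y, ‖f t x y‖ₑ ^ 2 := by
  unfold sliceNorm
  rw [← ENNReal.rpow_natCast, ← ENNReal.rpow_mul]; norm_num

namespace HasDecay

variable {f : ℝ → ℝ → ℝ → ℂ}

lemma measurable_sliceNorm (hf : HasDecay f) :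
    Measurable (fun ω : ℝ × ℝ => sliceNorm f ω.1 ω.2) := by
  have h : Measurable (fun q : (ℝ × ℝ) × ℝ => ‖f q.1.1 q.1.2 q.2‖ₑ ^ 2) :=
    (hf.meas.comp (f := fun q : (ℝ × ℝ) × ℝ => (q.1.1, q.1.2, q.2)) (by fun_prop)).enorm.pow_const 2
  exact (Measurable.lintegral_prod_right' (ν := volume) h).pow_const _

lemma measurable_lintegral_sliceNorm (hf : HasDecay f) :
    Measurable (fun t => ∫⁻ x, sliceNorm f t x) :=
  Measurable.lintegral_prod_right' (ν := volume) hf.measurable_sliceNorm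

lemma measurable_lintegral_sliceNorm_sq (hf : HasDecay f) :
    Measurable (fun t => ∫⁻ x, sliceNorm f t x ^ 2) :=
  Measurable.lintegral_prod_right' (ν := volume) (hf.measurable_sliceNorm.pow_const 2)

lemma lintegral_FTy_sq_le (hf : HasDecay f) (t x : ℝ) :
    ∫⁻ η, ‖FT1 (f t x) η‖ₑ ^ 2 ≤ ENNReal.ofReal (2 * π) * sliceNorm f t x ^ 2 := by
  rw [sliceNorm_sq]
  exact lintegral_FT1_sq_le (hf.measurable_slice t x) (hf.integrable_slice t x)

lemma lintegral_FTxy_sq_le (hf : HasDecay f) (t : ℝ) :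
    ∫⁻ q : ℝ × ℝ, ‖FT1 (fun x => FT1 (f t x) q.2) q.1‖ₑ ^ 2
      ≤ ENNReal.ofReal (2 * π) ^ 2 * ∫⁻ x, sliceNorm f t x ^ 2 := by
  have hm : Measurable (fun q : ℝ × ℝ => FT1 (fun x => FT1 (f t x) q.2) q.1) :=
    hf.measurable_FTxy.comp (f := fun q : ℝ × ℝ => ((t, q.2), q.1)) (by fun_prop)
  have hmy : Measurable (fun q : ℝ × ℝ => FT1 (f t q.2) q.1) :=
    hf.measurable_FTy.comp (f := fun q : ℝ × ℝ => ((t, q.2), q.1)) (by fun_prop)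
  obtain ⟨A, -, hA⟩ := hf.bound_FTy
  have hx : ∀ η, ∫⁻ ξ, ‖FT1 (fun x => FT1 (f t x) η) ξ‖ₑ ^ 2
      ≤ ENNReal.ofReal (2 * π) * ∫⁻ x, ‖FT1 (f t x) η‖ₑ ^ 2 := fun η => by
    have hms : Measurable (fun x => FT1 (f t x) η) :=
      hmy.comp (f := fun x : ℝ => (η, x)) (by fun_prop)
    exact lintegral_FT1_sq_le hms (integrable_of_decay_bound hms (B := A * quadDecay t)
      fun x => (hA t x η).trans_eq (by ring))
  calc ∫⁻ q : ℝ × ℝ, ‖FT1 (fun x => FT1 (f t x) q.2) q.1‖ₑ ^ 2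
      = ∫⁻ η, ∫⁻ ξ, ‖FT1 (fun x => FT1 (f t x) η) ξ‖ₑ ^ 2 := by
        rw [Measure.volume_eq_prod, lintegral_prod_symm _ (hm.enorm.pow_const 2).aemeasurable]
    _ ≤ ∫⁻ η, ENNReal.ofReal (2 * π) * ∫⁻ x, ‖FT1 (f t x) η‖ₑ ^ 2 := lintegral_mono hx
    _ = ENNReal.ofReal (2 * π) * ∫⁻ x, ∫⁻ η, ‖FT1 (f t x) η‖ₑ ^ 2 := by
        rw [lintegral_const_mul' _ _ ENNReal.ofReal_ne_top, lintegral_lintegral_swap]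
        exact (hmy.enorm.pow_const 2).aemeasurable
    _ ≤ ENNReal.ofReal (2 * π) * ∫⁻ x, ENNReal.ofReal (2 * π) * sliceNorm f t x ^ 2 := by
        gcongr with x
        exact hf.lintegral_FTy_sq_le t x
    _ = _ := by
        rw [lintegral_const_mul' _ _ ENNReal.ofReal_ne_top]; ring

lemma measurable_modulation_integrand (hf : HasDecay f) (r κ : ℝ) :
    Measurable (fun p : ℝ × ℝ × ℝ =>
      ENNReal.ofReal (Real.exp (-(r ^ 8)⁻¹ * (p.1 + κ * (p.2.1 ^ 2 + p.2.2 ^ 2)) ^ 2)) *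
        ‖FTtxy f p.1 p.2.1 p.2.2‖ₑ ^ 2) :=
  Measurable.mul (by fun_prop) (hf.measurable_FTtxy.enorm.pow_const 2)

lemma modulationEnergy_le_L2 (hf : HasDecay f) {r : ℝ} (hr : 1 ≤ r) (κ : ℝ) :
    modulationEnergy r κ f ≤ ENNReal.ofReal (2 * π) ^ 2 * ∫⁻ z : ℝ × ℝ, timeKernel r (z.1 - z.2) *
      ((∫⁻ x, sliceNorm f z.1 x ^ 2) ^ (1 / 2 : ℝ) *
        (∫⁻ x, sliceNorm f z.2 x ^ 2) ^ (1 / 2 : ℝ)) := by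
  have hr0 : 0 < r := by linarith
  have hk := measurable_timeKernel r
  have hm : Measurable (fun w : (ℝ × ℝ) × ℝ => FT1 (fun x => FT1 (f w.2 x) w.1.2) w.1.1) :=
    hf.measurable_FTxy.comp (f := fun w : (ℝ × ℝ) × ℝ => ((w.2, w.1.2), w.1.1)) (by fun_prop)
  have hm1 : Measurable (fun w : (ℝ × ℝ) × (ℝ × ℝ) =>
      FT1 (fun x => FT1 (f w.2.1 x) w.1.2) w.1.1) :=
    hm.comp (f := fun w : (ℝ × ℝ) × (ℝ × ℝ) => (w.1, w.2.1)) (by fun_prop)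
  have hm2 : Measurable (fun w : (ℝ × ℝ) × (ℝ × ℝ) =>
      FT1 (fun x => FT1 (f w.2.2 x) w.1.2) w.1.1) :=
    hm.comp (f := fun w : (ℝ × ℝ) × (ℝ × ℝ) => (w.1, w.2.2)) (by fun_prop)
  have hmt : ∀ t, Measurable (fun q : ℝ × ℝ => FT1 (fun x => FT1 (f t x) q.2) q.1) := fun t =>
    hm.comp (f := fun q : ℝ × ℝ => (q, t)) (by fun_prop)
  calc modulationEnergy r κ f
      = ∫⁻ q : ℝ × ℝ, ∫⁻ τ, ENNReal.ofReal
          (Real.exp (-(r ^ 8)⁻¹ * (τ + κ * (q.1 ^ 2 + q.2 ^ 2)) ^ 2)) *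
            ‖FT1 (fun t => FT1 (fun x => FT1 (f t x) q.2) q.1) τ‖ₑ ^ 2 := by
        unfold modulationEnergy
        rw [Measure.volume_eq_prod,
          lintegral_prod_symm _ (hf.measurable_modulation_integrand r κ).aemeasurable]
        simp only [FTtxy_eq_iterate]
    _ ≤ ∫⁻ q : ℝ × ℝ, ∫⁻ z : ℝ × ℝ, timeKernel r (z.1 - z.2) *
          (‖FT1 (fun x => FT1 (f z.1 x) q.2) q.1‖ₑ * ‖FT1 (fun x => FT1 (f z.2 x) q.2) q.1‖ₑ) := by
        refine lintegral_mono fun q => (lintegral_gaussian_mul_FT1_sq_le (by positivity) _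
          (hf.integrable_FTxy q.1 q.2)).trans (lintegral_mono fun z => ?_)
        gcongr
        exact gaussian_le_timeKernel hr _
    _ = ∫⁻ z : ℝ × ℝ, timeKernel r (z.1 - z.2) * ∫⁻ q : ℝ × ℝ,
          (‖FT1 (fun x => FT1 (f z.1 x) q.2) q.1‖ₑ * ‖FT1 (fun x => FT1 (f z.2 x) q.2) q.1‖ₑ) := by
        rw [lintegral_lintegral_swap]
        · refine lintegral_congr fun z => lintegral_const_mul _ ?_
          exact (hmt z.1).enorm.mul (hmt z.2).enorm
        · exact (Measurable.mul (by fun_prop) (hm1.enorm.mul hm2.enorm)).aemeasurable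
    _ ≤ ∫⁻ z : ℝ × ℝ, timeKernel r (z.1 - z.2) * (ENNReal.ofReal (2 * π) ^ 2 *
          ((∫⁻ x, sliceNorm f z.1 x ^ 2) ^ (1 / 2 : ℝ) *
            (∫⁻ x, sliceNorm f z.2 x ^ 2) ^ (1 / 2 : ℝ))) := by
        gcongr with z
        exact lintegral_mul_le_of_sq_le (hmt z.1).enorm (hmt z.2).enorm
          (hf.lintegral_FTxy_sq_le z.1) (hf.lintegral_FTxy_sq_le z.2)
    _ = _ := by
        rw [← lintegral_const_mul' _ _ (by finiteness)]
        congr 1; ext z; ring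

lemma modulationEnergy_le_L1 (hf : HasDecay f) {r κ : ℝ} (hr : 0 < r) (hκ : 1 ≤ κ) :
    modulationEnergy r κ f ≤ ENNReal.ofReal (2 * π) * ∫⁻ z : ℝ × ℝ, timeKernel r (z.1 - z.2) *
      ((∫⁻ x, sliceNorm f z.1 x) * ∫⁻ x, sliceNorm f z.2 x) := by
  have hk := measurable_timeKernel r
  have hN := hf.measurable_sliceNorm
  have hN1 := hf.measurable_lintegral_sliceNorm
  have hm1 : Measurable (fun w : ℝ × ((ℝ × ℝ) × (ℝ × ℝ)) => FT1 (f w.2.1.1 w.2.1.2) w.1) :=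
    hf.measurable_FTy.comp (f := fun w : ℝ × ((ℝ × ℝ) × (ℝ × ℝ)) => (w.2.1, w.1)) (by fun_prop)
  have hm2 : Measurable (fun w : ℝ × ((ℝ × ℝ) × (ℝ × ℝ)) => FT1 (f w.2.2.1 w.2.2.2) w.1) :=
    hf.measurable_FTy.comp (f := fun w : ℝ × ((ℝ × ℝ) × (ℝ × ℝ)) => (w.2.2, w.1)) (by fun_prop)
  have hmη : ∀ ω : ℝ × ℝ, Measurable (fun η => FT1 (f ω.1 ω.2) η) := fun ω =>
    measurable_FT1 (hf.measurable_slice ω.1 ω.2)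
  calc modulationEnergy r κ f
      = ∫⁻ η, ∫⁻ θ : ℝ × ℝ, ENNReal.ofReal
          (Real.exp (-(r ^ 8)⁻¹ * (θ.2 + (κ * θ.1 ^ 2 + κ * η ^ 2)) ^ 2)) *
            ‖∫ ω : ℝ × ℝ, cexp (-I * ((θ.2 * ω.1 + θ.1 * ω.2 : ℝ) : ℂ)) *
              FT1 (f ω.1 ω.2) η‖ₑ ^ 2 := by
        unfold modulationEnergy
        have hmi := hf.measurable_modulation_integrand r κ
        rw [Measure.volume_eq_prod, lintegral_prod_symm _ hmi.aemeasurable,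
          Measure.volume_eq_prod, lintegral_prod_symm _ hmi.lintegral_prod_left'.aemeasurable]
        refine lintegral_congr fun η => ?_
        rw [lintegral_prod]
        · simp only [hf.FTtxy_eq_plane, mul_add]
          rfl
        · exact (Measurable.mul (by fun_prop) ((measurable_plane_fourier
            (hf.measurable_FTy_slice η)).enorm.pow_const 2)).aemeasurable
    _ ≤ ∫⁻ η, ∫⁻ z : (ℝ × ℝ) × (ℝ × ℝ), timeKernel r (z.1.1 - z.2.1) *
          (‖FT1 (f z.1.1 z.1.2) η‖ₑ * ‖FT1 (f z.2.1 z.2.2) η‖ₑ) :=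
        lintegral_mono fun η => lintegral_paraboloid_sq_le _ hr hκ (hf.measurable_FTy_slice η)
          (hf.integrable_FTy η)
    _ = ∫⁻ z : (ℝ × ℝ) × (ℝ × ℝ), timeKernel r (z.1.1 - z.2.1) *
          ∫⁻ η, (‖FT1 (f z.1.1 z.1.2) η‖ₑ * ‖FT1 (f z.2.1 z.2.2) η‖ₑ) := by
        rw [lintegral_lintegral_swap]
        · refine lintegral_congr fun z => lintegral_const_mul _ ?_
          exact (hmη z.1).enorm.mul (hmη z.2).enorm
        · exact (Measurable.mul (by fun_prop) (hm1.enorm.mul hm2.enorm)).aemeasurable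
    _ ≤ ∫⁻ z : (ℝ × ℝ) × (ℝ × ℝ), timeKernel r (z.1.1 - z.2.1) * (ENNReal.ofReal (2 * π) *
          (sliceNorm f z.1.1 z.1.2 * sliceNorm f z.2.1 z.2.2)) := by
        gcongr with z
        refine (lintegral_mul_le_of_sq_le (hmη z.1).enorm (hmη z.2).enorm
          (hf.lintegral_FTy_sq_le z.1.1 z.1.2) (hf.lintegral_FTy_sq_le z.2.1 z.2.2)).trans_eq ?_
        rw [sliceNorm_sq, sliceNorm_sq]; rfl
    _ = ENNReal.ofReal (2 * π) * ∫⁻ z : (ℝ × ℝ) × (ℝ × ℝ), timeKernel r (z.1.1 - z.2.1) *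
          (sliceNorm f z.1.1 z.1.2 * sliceNorm f z.2.1 z.2.2) := by
        rw [← lintegral_const_mul' _ _ (by finiteness)]
        congr 1; ext z; ring
    _ = _ := by
        congr 1
        have hmz : Measurable (fun z : (ℝ × ℝ) × (ℝ × ℝ) => timeKernel r (z.1.1 - z.2.1) *
            (sliceNorm f z.1.1 z.1.2 * sliceNorm f z.2.1 z.2.2)) :=
          Measurable.mul (by fun_prop)
            ((hN.comp measurable_fst).mul (hN.comp measurable_snd))
        have hNt : ∀ t, Measurable (sliceNorm f t) := fun t =>
          hN.comp (f := fun x : ℝ => (t, x)) (by fun_prop)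
        have hQ : Measurable (fun t => ∫⁻ t', timeKernel r (t - t') * ∫⁻ x, sliceNorm f t' x) :=
          Measurable.lintegral_prod_right' (ν := volume)
            (f := fun q : ℝ × ℝ => timeKernel r (q.1 - q.2) * ∫⁻ x, sliceNorm f q.2 x)
            (by fun_prop)
        have inner : ∀ ω : ℝ × ℝ, ∫⁻ ω' : ℝ × ℝ, timeKernel r (ω.1 - ω'.1) *
            (sliceNorm f ω.1 ω.2 * sliceNorm f ω'.1 ω'.2)
            = sliceNorm f ω.1 ω.2 * ∫⁻ t', timeKernel r (ω.1 - t') * ∫⁻ x, sliceNorm f t' x := by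
          intro ω
          rw [Measure.volume_eq_prod, lintegral_prod]
          swap
          · exact (hmz.comp (f := fun ω' : ℝ × ℝ => (ω, ω')) (by fun_prop)).aemeasurable
          rw [← lintegral_const_mul _ (by fun_prop)]
          refine lintegral_congr fun t' => ?_
          simp only
          rw [← lintegral_const_mul _ (hNt t'), ← lintegral_const_mul _ ((hNt t').const_mul _)]
          exact lintegral_congr fun x => by ring
        rw [Measure.volume_eq_prod, lintegral_prod _ hmz.aemeasurable]
        simp only [inner]
        rw [Measure.volume_eq_prod, lintegral_prod]
        swap
        · exact (hN.mul (hQ.comp measurable_fst)).aemeasurable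
        rw [lintegral_prod]
        swap
        · exact Measurable.aemeasurable (by fun_prop)
        refine lintegral_congr fun t => ?_
        simp only
        rw [lintegral_mul_const _ (hNt t), ← lintegral_const_mul _ (by fun_prop)]
        exact lintegral_congr fun t' => by ring

end HasDecay

lemma setLIntegral_timeKernel_nonneg_side {r T : ℝ} (hr : 0 < r) (hT : 0 < T) :
    ∫⁻ u in Set.Icc 0 T, timeKernel r u = ENNReal.ofReal (4 * π * r ^ 3 * T ^ (1 / 4 : ℝ)) := by
  have hint : IntegrableOn (fun u : ℝ => π * r ^ 3 * u ^ (-(3 / 4) : ℝ)) (Set.Ioc 0 T) :=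
    ((intervalIntegrable_iff_integrableOn_Ioc_of_le hT.le).1
      (intervalIntegral.intervalIntegrable_rpow' (by norm_num))).const_mul _
  calc ∫⁻ u in Set.Icc 0 T, timeKernel r u
      = ∫⁻ u in Set.Ioc 0 T, timeKernel r u := by rw [restrict_Ioc_eq_restrict_Icc]
    _ = ∫⁻ u in Set.Ioc 0 T, ENNReal.ofReal (π * r ^ 3 * u ^ (-(3 / 4) : ℝ)) :=
        setLIntegral_congr_fun measurableSet_Ioc fun u hu => by
          rw [timeKernel_of_ne hr hu.1.ne', abs_of_pos hu.1]
    _ = ENNReal.ofReal (∫ u in Set.Ioc 0 T, π * r ^ 3 * u ^ (-(3 / 4) : ℝ)) := by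
        rw [ofReal_integral_eq_lintegral_ofReal hint]
        filter_upwards [ae_restrict_mem measurableSet_Ioc] with u hu
        have := hu.1.le
        positivity
    _ = _ := by
        rw [integral_const_mul, ← intervalIntegral.integral_of_le hT.le,
          integral_rpow (Or.inl (by norm_num)), Real.zero_rpow (by norm_num)]
        congr 1
        norm_num
        ring

lemma setLIntegral_timeKernel_le {r T : ℝ} (hr : 0 < r) (hT : 0 < T) :
    ∫⁻ u in Set.Icc (-T) T, timeKernel r u ≤ ENNReal.ofReal (8 * π * r ^ 3 * T ^ (1 / 4 : ℝ)) := by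
  have hneg : ∫⁻ u in Set.Icc (-T) 0, timeKernel r u = ∫⁻ u in Set.Icc 0 T, timeKernel r u := by
    have h := (Measure.measurePreserving_neg (volume : Measure ℝ)).setLIntegral_comp_preimage
      (s := Set.Icc 0 T) measurableSet_Icc (measurable_timeKernel r)
    rw [← h]
    simp [timeKernel_neg]
  calc ∫⁻ u in Set.Icc (-T) T, timeKernel r u
      = ∫⁻ u in Set.Icc (-T) 0 ∪ Set.Icc 0 T, timeKernel r u := by
        rw [Set.Icc_union_Icc_eq_Icc (by linarith) hT.le]
    _ ≤ (∫⁻ u in Set.Icc (-T) 0, timeKernel r u) + ∫⁻ u in Set.Icc 0 T, timeKernel r u :=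
        lintegral_union_le _ _ _
    _ = _ := by
        rw [hneg, setLIntegral_timeKernel_nonneg_side hr hT, ← ENNReal.ofReal_add (by positivity)
          (by positivity)]
        congr 1; ring

lemma lintegral_timeKernel_mul_le {r T : ℝ} (hr : 0 < r) (hT : 0 < T) {N : ℝ → ℝ≥0∞}
    (hN : Measurable N) (hsupp : ∀ t, t ∉ Set.Icc 0 T → N t = 0) :
    ∫⁻ z : ℝ × ℝ, timeKernel r (z.1 - z.2) * (N z.1 * N z.2)
      ≤ ENNReal.ofReal (8 * π * r ^ 3 * T ^ (1 / 4 : ℝ)) * ∫⁻ t, N t ^ 2 := by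
  set k : ℝ → ℝ≥0∞ := (Set.Icc (-T) T).indicator (timeKernel r) with hk
  calc ∫⁻ z : ℝ × ℝ, timeKernel r (z.1 - z.2) * (N z.1 * N z.2)
      = ∫⁻ z : ℝ × ℝ, k (z.1 - z.2) * (N z.1 * N z.2) := by
        refine lintegral_congr fun z => ?_
        by_cases h1 : z.1 ∈ Set.Icc 0 T
        · by_cases h2 : z.2 ∈ Set.Icc 0 T
          · rw [hk, Set.indicator_of_mem]
            exact ⟨by linarith [h1.1, h2.2], by linarith [h1.2, h2.1]⟩
          · simp [hsupp _ h2]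
        · simp [hsupp _ h1]
    _ ≤ (∫⁻ u, k u) * ∫⁻ t, N t ^ 2 := by
        refine lintegral_conv_mul_le ((measurable_timeKernel r).indicator measurableSet_Icc)
          (fun u => ?_) hN
        simp only [hk, Set.indicator_apply, Set.mem_Icc, timeKernel_neg]
        congr 1
        rw [neg_le_neg_iff, neg_le]
        exact propext and_comm
    _ ≤ _ := by
        gcongr
        rw [hk, lintegral_indicator measurableSet_Icc]
        exact setLIntegral_timeKernel_le hr hT

/-- The inhomogeneous weight of order `-7/8` is dominated by a geometric sum of Gaussians. -/
lemma weight_le_tsum_gaussian (σ : ℝ) :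
    ENNReal.ofReal ((1 + |σ|) ^ (-(7 / 8) : ℝ)) ≤ ENNReal.ofReal (Real.exp 65536) *
      ∑' n : ℕ, ENNReal.ofReal ((1 / 128) ^ n) *
        ENNReal.ofReal (Real.exp (-(((4 : ℝ) ^ n) ^ 8)⁻¹ * σ ^ 2)) := by
  obtain ⟨n, hn1, hn2⟩ := exists_nat_pow_near (x := 1 + |σ|) (y := 256)
    (by linarith [abs_nonneg σ]) (by norm_num)
  refine le_trans ?_ (mul_le_mul_right (ENNReal.le_tsum n) _)
  rw [← ENNReal.ofReal_mul (by positivity), ← ENNReal.ofReal_mul (by positivity)]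
  refine ENNReal.ofReal_le_ofReal ?_
  have h256 : (0 : ℝ) < 256 ^ n := by positivity
  have hpow : ((4 : ℝ) ^ n) ^ 8 = (256 ^ n) ^ 2 := by
    rw [← pow_mul, ← pow_mul, show (256 : ℝ) = 4 ^ 4 by norm_num, ← pow_mul]; congr 1; ring
  have hexp : 1 ≤ Real.exp 65536 * Real.exp (-(((4 : ℝ) ^ n) ^ 8)⁻¹ * σ ^ 2) := by
    rw [← Real.exp_add, hpow]
    refine Real.one_le_exp ?_
    have hσ : σ ^ 2 ≤ 65536 * (256 ^ n) ^ 2 := by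
      rw [pow_succ] at hn2
      rw [← sq_abs]
      nlinarith [abs_nonneg σ]
    have : ((256 ^ n : ℝ) ^ 2)⁻¹ * σ ^ 2 ≤ 65536 := by
      rw [inv_mul_le_iff₀ (by positivity)]; linarith
    linarith
  have hw : (1 + |σ|) ^ (-(7 / 8) : ℝ) ≤ (1 / 128) ^ n := by
    calc (1 + |σ|) ^ (-(7 / 8) : ℝ) ≤ ((256 : ℝ) ^ n) ^ (-(7 / 8) : ℝ) :=
          Real.rpow_le_rpow_of_nonpos h256 hn1 (by norm_num)
      _ = (1 / 128) ^ n := by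
          rw [← Real.rpow_natCast, ← Real.rpow_mul (by norm_num), mul_comm,
            Real.rpow_mul (by norm_num), Real.rpow_natCast]
          congr 1
          rw [show (256 : ℝ) = 2 ^ (8 : ℝ) by norm_num, ← Real.rpow_mul (by norm_num)]
          norm_num
  calc _ ≤ (1 / 128 : ℝ) ^ n * 1 := by rw [mul_one]; exact hw
    _ ≤ (1 / 128 : ℝ) ^ n *
        (Real.exp 65536 * Real.exp (-(((4 : ℝ) ^ n) ^ 8)⁻¹ * σ ^ 2)) := by gcongr
    _ = _ := by ring

/-- The squared Bourgain norm of order `-7/16` adapted to the paraboloid `τ + κ(ξ² + η²) = 0`. -/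
def bourgainEnergy (κ : ℝ) (f : ℝ → ℝ → ℝ → ℂ) : ℝ≥0∞ :=
  ∫⁻ p : ℝ × ℝ × ℝ, ENNReal.ofReal ((1 + |p.1 + κ * (p.2.1 ^ 2 + p.2.2 ^ 2)|) ^ (-(7 / 8) : ℝ)) *
    ‖FTtxy f p.1 p.2.1 p.2.2‖ₑ ^ 2

namespace HasDecay

variable {f : ℝ → ℝ → ℝ → ℂ}

lemma bourgainEnergy_le_tsum (hf : HasDecay f) (κ : ℝ) :
    bourgainEnergy κ f ≤ ENNReal.ofReal (Real.exp 65536) *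
      ∑' n : ℕ, ENNReal.ofReal ((1 / 128) ^ n) * modulationEnergy (4 ^ n) κ f := by
  have hm := fun n : ℕ => hf.measurable_modulation_integrand (4 ^ n) κ
  unfold modulationEnergy
  simp_rw [← lintegral_const_mul' _ _ ENNReal.ofReal_ne_top]
  rw [← lintegral_tsum fun n => ((hm n).const_mul _).aemeasurable,
    ← lintegral_const_mul' _ _ ENNReal.ofReal_ne_top]
  refine lintegral_mono fun p => ?_
  refine (mul_le_mul_left (weight_le_tsum_gaussian _) _).trans_eq ?_
  rw [mul_assoc, ← ENNReal.tsum_mul_right]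
  simp_rw [mul_assoc]

lemma bourgainEnergy_le_of_modulationEnergy_le (hf : HasDecay f) {κ T : ℝ}
    {K D : ℝ≥0∞} (h : ∀ n : ℕ, modulationEnergy (4 ^ n) κ f
      ≤ K * (ENNReal.ofReal (8 * π * (4 ^ n) ^ 3 * T ^ (1 / 4 : ℝ)) * D)) :
    bourgainEnergy κ f ≤ ENNReal.ofReal (Real.exp 65536 * (16 * π)) * K *
      (ENNReal.ofReal (T ^ (1 / 4 : ℝ)) * D) := by
  have hsum : ∑' n : ℕ, ENNReal.ofReal ((1 / 2) ^ n) = 2 := by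
    rw [← ENNReal.ofReal_tsum_of_nonneg (fun n => by positivity) summable_geometric_two,
      tsum_geometric_two]
    norm_num
  calc bourgainEnergy κ f
      ≤ ENNReal.ofReal (Real.exp 65536) * ∑' n : ℕ, ENNReal.ofReal ((1 / 128) ^ n) *
          (K * (ENNReal.ofReal (8 * π * (4 ^ n) ^ 3 * T ^ (1 / 4 : ℝ)) * D)) := by
        refine (hf.bourgainEnergy_le_tsum κ).trans ?_
        gcongr with n
        exact h n
    _ = ENNReal.ofReal (Real.exp 65536) * ∑' n : ℕ, ENNReal.ofReal ((1 / 2) ^ n) *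
          (ENNReal.ofReal (8 * π) * K * (ENNReal.ofReal (T ^ (1 / 4 : ℝ)) * D)) := by
        congr 1
        refine tsum_congr fun n => ?_
        have hr : (1 / 128 : ℝ) ^ n * (8 * π * (4 ^ n) ^ 3 * T ^ (1 / 4 : ℝ))
            = (1 / 2) ^ n * (8 * π) * T ^ (1 / 4 : ℝ) := by
          have : (1 / 128 : ℝ) ^ n * (4 ^ n) ^ 3 = (1 / 2) ^ n := by
            rw [← pow_mul, mul_comm n 3, pow_mul, ← mul_pow]; norm_num
          rw [← this]; ring
        calc _ = ENNReal.ofReal ((1 / 128) ^ n) *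
              ENNReal.ofReal (8 * π * (4 ^ n) ^ 3 * T ^ (1 / 4 : ℝ)) * (K * D) := by ring
          _ = _ := by
              rw [← ENNReal.ofReal_mul (by positivity), hr, ENNReal.ofReal_mul (by positivity),
                ENNReal.ofReal_mul (by positivity)]
              ring
    _ = _ := by
        rw [ENNReal.tsum_mul_right, hsum, ENNReal.ofReal_mul (p := Real.exp 65536) (by positivity),
          show 16 * π = 2 * (8 * π) by ring, ENNReal.ofReal_mul (p := 2) (by norm_num)]
        norm_num
        ring

lemma bourgainEnergy_le_L2 (hf : HasDecay f) {T : ℝ} (hT : 0 < T) (κ : ℝ)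
    (hsupp : ∀ t x y, t ∉ Set.Icc 0 T → f t x y = 0) :
    bourgainEnergy κ f ≤ ENNReal.ofReal (Real.exp 65536 * (16 * π)) * ENNReal.ofReal (2 * π) ^ 2 *
      (ENNReal.ofReal (T ^ (1 / 4 : ℝ)) * ∫⁻ t, ∫⁻ x, sliceNorm f t x ^ 2) := by
  refine hf.bourgainEnergy_le_of_modulationEnergy_le fun n => ?_
  refine (hf.modulationEnergy_le_L2 (one_le_pow₀ (by norm_num)) κ).trans ?_
  gcongr
  refine (lintegral_timeKernel_mul_le (by positivity) hT
    (N := fun t => (∫⁻ x, sliceNorm f t x ^ 2) ^ (1 / 2 : ℝ))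
    (hf.measurable_lintegral_sliceNorm_sq.pow_const _) fun t ht => ?_).trans_eq ?_
  · simp [sliceNorm_sq, hsupp t _ _ ht]
  · congr 2 with t
    rw [← ENNReal.rpow_natCast, ← ENNReal.rpow_mul]; norm_num

lemma bourgainEnergy_le_L1 (hf : HasDecay f) {T κ : ℝ} (hT : 0 < T) (hκ : 1 ≤ κ)
    (hsupp : ∀ t x y, t ∉ Set.Icc 0 T → f t x y = 0) :
    bourgainEnergy κ f ≤ ENNReal.ofReal (Real.exp 65536 * (16 * π)) * ENNReal.ofReal (2 * π) *
      (ENNReal.ofReal (T ^ (1 / 4 : ℝ)) * ∫⁻ t, (∫⁻ x, sliceNorm f t x) ^ 2) := by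
  refine hf.bourgainEnergy_le_of_modulationEnergy_le fun n => ?_
  refine (hf.modulationEnergy_le_L1 (by positivity) hκ).trans ?_
  gcongr
  refine lintegral_timeKernel_mul_le (by positivity) hT
    (N := fun t => ∫⁻ x, sliceNorm f t x) hf.measurable_lintegral_sliceNorm fun t ht => ?_
  simp [sliceNorm, hsupp t _ _ ht]

end HasDecay

lemma lintegral_superlevel_le {N : ℝ → ℝ≥0∞} (hN : Measurable N) {p : ℝ} (hp : 1 < p) :
    ∫⁻ x, {x | (∫⁻ x, N x ^ p) ^ p⁻¹ < N x}.indicator N x ≤ (∫⁻ x, N x ^ p) ^ p⁻¹ := by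
  set A := (∫⁻ x, N x ^ p) ^ p⁻¹ with hA
  have hp0 : 0 < p := by linarith
  have hAp : ∫⁻ x, N x ^ p = A ^ p := by
    rw [hA, ← ENNReal.rpow_mul, inv_mul_cancel₀ hp0.ne', ENNReal.rpow_one]
  rcases eq_or_ne A ⊤ with hAt | hAt
  · rw [hAt]; exact le_top
  rcases eq_or_ne A 0 with hA0 | hA0
  · rw [hA0, ENNReal.zero_rpow_of_pos hp0, lintegral_eq_zero_iff (hN.pow_const _)] at hAp
    rw [nonpos_iff_eq_zero.1 hA0.le, nonpos_iff_eq_zero]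
    refine (lintegral_congr_ae ?_).trans lintegral_zero
    filter_upwards [hAp] with x hx
    have : N x = 0 := by simpa [hp0, hp0.not_gt] using hx
    simp [this]
  have hpos : A ^ (p - 1) ≠ 0 := by simp [hA0, hAt]
  have hfin : A ^ (p - 1) ≠ ⊤ := by simp [hA0, hAt]
  have hadd : ∀ a : ℝ≥0∞, a ^ (p - 1) * a = a ^ p := fun a => by
    conv_lhs => rw [← ENNReal.rpow_one a, ← ENNReal.rpow_mul, one_mul,
      ← ENNReal.rpow_add_of_nonneg _ _ (by linarith) (by norm_num)]
    congr 1; ring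
  rw [← ENNReal.mul_le_mul_iff_right hpos hfin, hadd, ← hAp,
    ← lintegral_const_mul' _ _ hfin]
  refine lintegral_mono fun x => ?_
  by_cases hx : A < N x
  · rw [Set.indicator_of_mem (by exact hx), ← hadd (N x)]
    gcongr
  · rw [Set.indicator_of_notMem (by exact hx)]; simp

lemma lintegral_sublevel_sq_le {N : ℝ → ℝ≥0∞} {p : ℝ} (hp : 1 < p)
    (hp2 : p ≤ 2) :
    ∫⁻ x, {x | (∫⁻ x, N x ^ p) ^ p⁻¹ < N x}ᶜ.indicator N x ^ 2 ≤ ((∫⁻ x, N x ^ p) ^ p⁻¹) ^ 2 := by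
  set A := (∫⁻ x, N x ^ p) ^ p⁻¹ with hA
  have hp0 : 0 < p := by linarith
  have hAp : ∫⁻ x, N x ^ p = A ^ p := by
    rw [hA, ← ENNReal.rpow_mul, inv_mul_cancel₀ hp0.ne', ENNReal.rpow_one]
  rcases eq_or_ne A ⊤ with hAt | hAt
  · rw [hAt]; simp
  have hadd : ∀ a : ℝ≥0∞, a ^ (2 - p) * a ^ p = a ^ 2 := fun a => by
    rw [← ENNReal.rpow_add_of_nonneg _ _ (by linarith) hp0.le, ← ENNReal.rpow_natCast]
    congr 1; push_cast; ring
  rw [← hadd A, ← hAp, ← lintegral_const_mul' _ _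
    (ENNReal.rpow_ne_top_of_nonneg (by linarith) hAt)]
  refine lintegral_mono fun x => ?_
  by_cases hx : A < N x
  · rw [Set.indicator_of_notMem (by simpa using hx)]; simp
  · rw [Set.indicator_of_mem (by simpa using hx), ← hadd (N x)]
    exact mul_le_mul_left (ENNReal.rpow_le_rpow (not_lt.1 hx) (by linarith)) _

/-- Restriction of `f` to the set of `(t, x)` in `S`. -/
def restrictPlane (S : Set (ℝ × ℝ)) (f : ℝ → ℝ → ℝ → ℂ) (t x y : ℝ) : ℂ :=
  S.indicator (fun ω => f ω.1 ω.2 y) (t, x)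

lemma sliceNorm_restrictPlane (S : Set (ℝ × ℝ)) (f : ℝ → ℝ → ℝ → ℂ) (t x : ℝ) :
    sliceNorm (restrictPlane S f) t x = S.indicator (fun ω => sliceNorm f ω.1 ω.2) (t, x) := by
  by_cases h : (t, x) ∈ S <;> simp [sliceNorm, restrictPlane, h]

lemma bourgainEnergy_le_add {f g h : ℝ → ℝ → ℝ → ℂ} (hf : HasDecay f) (κ : ℝ)
    (hadd : ∀ τ ξ η, FTtxy h τ ξ η = FTtxy f τ ξ η + FTtxy g τ ξ η) :
    bourgainEnergy κ h ≤ 2 * (bourgainEnergy κ f + bourgainEnergy κ g) := by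
  unfold bourgainEnergy
  have hm : Measurable (fun p : ℝ × ℝ × ℝ =>
      ENNReal.ofReal ((1 + |p.1 + κ * (p.2.1 ^ 2 + p.2.2 ^ 2)|) ^ (-(7 / 8) : ℝ)) *
        ‖FTtxy f p.1 p.2.1 p.2.2‖ₑ ^ 2) :=
    Measurable.mul (by fun_prop) (hf.measurable_FTtxy.enorm.pow_const 2)
  rw [← lintegral_add_left hm, ← lintegral_const_mul' _ _ (by norm_num)]
  refine lintegral_mono fun p => ?_
  rw [hadd, ← mul_add, mul_left_comm]
  gcongr
  calc _ ≤ (‖FTtxy f p.1 p.2.1 p.2.2‖ₑ + ‖FTtxy g p.1 p.2.1 p.2.2‖ₑ) ^ 2 := by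
        gcongr; exact enorm_add_le _ _
    _ = ‖FTtxy f p.1 p.2.1 p.2.2‖ₑ ^ 2 + ‖FTtxy g p.1 p.2.1 p.2.2‖ₑ ^ 2 +
          2 * (‖FTtxy f p.1 p.2.1 p.2.2‖ₑ * ‖FTtxy g p.1 p.2.1 p.2.2‖ₑ) := by ring
    _ ≤ _ := by
        rw [two_mul (_ + _)]
        gcongr
        refine (mul_le_mul_right (mul_le_half_sq_add_half_sq _ _) 2).trans_eq ?_
        rw [mul_add, ← mul_assoc, ← mul_assoc, ENNReal.mul_inv_cancel (by norm_num) (by norm_num),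
          one_mul, one_mul]

namespace HasDecay

variable {f : ℝ → ℝ → ℝ → ℂ}

lemma restrictPlane (hf : HasDecay f) {S : Set (ℝ × ℝ)} (hS : MeasurableSet S) :
    HasDecay (restrictPlane S f) where
  meas := by
    have hm : Measurable (fun q : ℝ × ℝ × ℝ => (q.1, q.2.1)) := by fun_prop
    exact hf.meas.indicator (hm hS)
  bound := by
    obtain ⟨A, hA0, hA⟩ := hf.bound
    refine ⟨A, hA0, fun t x y => (hA t x y).trans' ?_⟩
    by_cases h : (t, x) ∈ S <;> simp [_root_.restrictPlane, h]

lemma FTtxy_restrictPlane_add (hf : HasDecay f) {S : Set (ℝ × ℝ)} (hS : MeasurableSet S)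
    (τ ξ η : ℝ) :
    FTtxy f τ ξ η = FTtxy (_root_.restrictPlane S f) τ ξ η +
      FTtxy (_root_.restrictPlane Sᶜ f) τ ξ η := by
  have hint : ∀ {g : ℝ → ℝ → ℝ → ℂ}, HasDecay g → Integrable (fun ω : ℝ × ℝ =>
      cexp (-I * ((τ * ω.1 + ξ * ω.2 : ℝ) : ℂ)) * FT1 (g ω.1 ω.2) η) := fun hg =>
    (hg.integrable_FTy η).bdd_mul (c := 1) (by fun_prop)
      (ae_of_all _ fun ω => (norm_exp_neg_I_mul _).le)
  have h1 := hf.restrictPlane hS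
  have h2 := hf.restrictPlane hS.compl
  rw [hf.FTtxy_eq_plane, h1.FTtxy_eq_plane, h2.FTtxy_eq_plane,
    ← integral_add (hint h1) (hint h2)]
  congr 1; ext ω
  rw [← mul_add]
  congr 1
  by_cases h : ω ∈ S <;> simp [FT1, _root_.restrictPlane, h]

lemma bourgainEnergy_le_mixed (hf : HasDecay f) {p T κ : ℝ} (hp : 1 < p) (hp2 : p ≤ 2)
    (hT : 0 < T) (hκ : 1 ≤ κ) (hsupp : ∀ t x y, t ∉ Set.Icc 0 T → f t x y = 0) :
    bourgainEnergy κ f ≤ 4 * (ENNReal.ofReal (Real.exp 65536 * (16 * π)) *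
      ENNReal.ofReal (2 * π) ^ 2) *
      (ENNReal.ofReal (T ^ (1 / 4 : ℝ)) * ∫⁻ t, ((∫⁻ x, sliceNorm f t x ^ p) ^ p⁻¹) ^ 2) := by
  set A : ℝ → ℝ≥0∞ := fun t => (∫⁻ x, sliceNorm f t x ^ p) ^ p⁻¹ with hA
  have hN := hf.measurable_sliceNorm
  have hAm : Measurable A :=
    (Measurable.lintegral_prod_right' (ν := volume) (hN.pow_const p)).pow_const _
  have hNt : ∀ t, Measurable (sliceNorm f t) := fun t =>
    hN.comp (f := fun x : ℝ => (t, x)) (by fun_prop)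
  set S : Set (ℝ × ℝ) := {ω | A ω.1 < sliceNorm f ω.1 ω.2} with hSdef
  have hS : MeasurableSet S := measurableSet_lt (hAm.comp measurable_fst) hN
  have hs : ∀ S' : Set (ℝ × ℝ), ∀ t x y, t ∉ Set.Icc 0 T → _root_.restrictPlane S' f t x y = 0 :=
    fun S' t x y ht => by simp [_root_.restrictPlane, hsupp t x y ht]
  have hpi : (1 : ℝ≥0∞) ≤ ENNReal.ofReal (2 * π) := by
    rw [ENNReal.one_le_ofReal]; linarith [Real.pi_gt_three]
  set K := ENNReal.ofReal (Real.exp 65536 * (16 * π))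
  have hhigh : bourgainEnergy κ (_root_.restrictPlane S f) ≤ K * ENNReal.ofReal (2 * π) ^ 2 *
      (ENNReal.ofReal (T ^ (1 / 4 : ℝ)) * ∫⁻ t, A t ^ 2) := by
    refine ((hf.restrictPlane hS).bourgainEnergy_le_L1 hT hκ (hs S)).trans ?_
    gcongr with t
    · exact le_self_pow₀ hpi (by norm_num)
    · refine le_trans (le_of_eq ?_) (lintegral_superlevel_le (hNt t) hp)
      refine lintegral_congr fun x => ?_
      rw [sliceNorm_restrictPlane]
      rfl
  have hlow : bourgainEnergy κ (_root_.restrictPlane Sᶜ f) ≤ K * ENNReal.ofReal (2 * π) ^ 2 *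
      (ENNReal.ofReal (T ^ (1 / 4 : ℝ)) * ∫⁻ t, A t ^ 2) := by
    refine ((hf.restrictPlane hS.compl).bourgainEnergy_le_L2 hT κ (hs Sᶜ)).trans ?_
    gcongr with t
    refine le_trans (le_of_eq ?_) (lintegral_sublevel_sq_le hp hp2)
    refine lintegral_congr fun x => ?_
    rw [sliceNorm_restrictPlane]
    rfl
  refine (bourgainEnergy_le_add (hf.restrictPlane hS) κ
    (hf.FTtxy_restrictPlane_add hS)).trans
      ((mul_le_mul_right (add_le_add hhigh hlow) 2).trans_eq ?_)
  ring

lemma sliceNorm_le (hf : HasDecay f) :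
    ∃ B : ℝ, 0 ≤ B ∧ ∀ t x, sliceNorm f t x ≤ ENNReal.ofReal (B * quadDecay x) := by
  obtain ⟨A, hA0, hA⟩ := hf.bound
  have hI := integral_quadDecay_nonneg
  refine ⟨A * (∫ y, quadDecay y) ^ (1 / 2 : ℝ), by positivity, fun t x => ?_⟩
  have hx := quadDecay_pos x
  have h : ∫⁻ y, ‖f t x y‖ₑ ^ 2 ≤ ENNReal.ofReal ((A * quadDecay x) ^ 2 * ∫ y, quadDecay y) := by
    rw [← integral_const_mul, ofReal_integral_eq_lintegral_ofReal
      (integrable_quadDecay.const_mul _)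
      (ae_of_all _ fun y => mul_nonneg (sq_nonneg _) (quadDecay_pos y).le)]
    refine lintegral_mono fun y => ?_
    rw [← ofReal_norm, ← ENNReal.ofReal_pow (norm_nonneg _)]
    refine ENNReal.ofReal_le_ofReal ?_
    have hy := quadDecay_pos y
    calc ‖f t x y‖ ^ 2 ≤ (A * (quadDecay t * quadDecay x * quadDecay y)) ^ 2 := by
          gcongr; exact hA t x y
      _ ≤ (A * (1 * quadDecay x * quadDecay y)) ^ 2 := by
          have := quadDecay_pos t
          gcongr
          exact quadDecay_le_one t
      _ = (A * quadDecay x) ^ 2 * (quadDecay y * quadDecay y) := by ring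
      _ ≤ (A * quadDecay x) ^ 2 * (1 * quadDecay y) := by
          gcongr
          exact quadDecay_le_one y
      _ = _ := by ring
  unfold sliceNorm
  refine (ENNReal.rpow_le_rpow h (by norm_num)).trans_eq ?_
  rw [ENNReal.ofReal_rpow_of_nonneg (by positivity) (by norm_num),
    Real.mul_rpow (by positivity) hI, ← Real.rpow_natCast, ← Real.rpow_mul (by positivity)]
  norm_num
  ring_nf

lemma lintegral_sliceNorm_rpow_lt_top (hf : HasDecay f) {p : ℝ} (hp : 1 < p) (t : ℝ) :
    ∫⁻ x, sliceNorm f t x ^ p < ⊤ := by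
  obtain ⟨B, hB, h⟩ := hf.sliceNorm_le
  have hp0 : 0 < p := by linarith
  calc ∫⁻ x, sliceNorm f t x ^ p
      ≤ ∫⁻ x, ENNReal.ofReal (B ^ p * quadDecay x) := by
        refine lintegral_mono fun x => ?_
        have hx := quadDecay_pos x
        refine (ENNReal.rpow_le_rpow (h t x) hp0.le).trans ?_
        rw [ENNReal.ofReal_rpow_of_nonneg (by positivity) hp0.le, Real.mul_rpow hB hx.le]
        refine ENNReal.ofReal_le_ofReal ?_
        gcongr
        exact Real.rpow_le_self_of_le_one hx.le (quadDecay_le_one x) hp.le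
    _ < ⊤ := (integrable_quadDecay.const_mul (B ^ p)).lintegral_lt_top

lemma MixedN3_eq (hf : HasDecay f) {p : ℝ} (hp : 1 < p) :
    MixedN3 volume 2 (ENNReal.ofReal p) 2 f
      = (∫⁻ t, ((∫⁻ x, sliceNorm f t x ^ p) ^ p⁻¹) ^ 2) ^ (1 / 2 : ℝ) := by
  have hp0 : 0 < p := by linarith
  obtain ⟨B, -, hB⟩ := hf.sliceNorm_le
  have hslice : ∀ t x, eLpNorm (f t x) 2 volume = sliceNorm f t x := fun t x => by
    rw [eLpNorm_eq_lintegral_rpow_enorm_toReal (by norm_num) (by norm_num)]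
    simp [sliceNorm]
  have hfin : ∀ t x, sliceNorm f t x ≠ ⊤ := fun t x =>
    ((hB t x).trans_lt ENNReal.ofReal_lt_top).ne
  have hinner : ∀ t, eLpNorm (fun x => (eLpNorm (f t x) 2 volume).toReal) (ENNReal.ofReal p) volume
      = (∫⁻ x, sliceNorm f t x ^ p) ^ p⁻¹ := fun t => by
    rw [eLpNorm_eq_lintegral_rpow_enorm_toReal (by simpa using hp0) ENNReal.ofReal_ne_top,
      ENNReal.toReal_ofReal hp0.le, one_div]
    simp only [hslice, Real.enorm_eq_ofReal ENNReal.toReal_nonneg, ENNReal.ofReal_toReal (hfin _ _)]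
  have hfin' : ∀ t, (∫⁻ x, sliceNorm f t x ^ p) ^ p⁻¹ ≠ ⊤ := fun t =>
    ENNReal.rpow_ne_top_of_nonneg (by positivity) (hf.lintegral_sliceNorm_rpow_lt_top hp t).ne
  unfold MixedN3
  rw [eLpNorm_eq_lintegral_rpow_enorm_toReal (by norm_num) (by norm_num)]
  simp only [hinner, Real.enorm_eq_ofReal ENNReal.toReal_nonneg, ENNReal.ofReal_toReal (hfin' _)]
  simp

end HasDecay

lemma XbNorm_eq (u : ℝ → ℝ → ℝ → ℂ) :
    XbNorm (-(1 / 2) + 1 / 16) u = bourgainEnergy 1 u ^ (1 / 2 : ℝ) := by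
  unfold XbNorm bourgainEnergy
  rw [eLpNorm_eq_lintegral_rpow_enorm_toReal (by norm_num) (by norm_num)]
  simp only [ENNReal.toReal_ofNat, ENNReal.rpow_ofNat]
  congr 2 with p
  have hpos : 0 < 1 + |p.1 + p.2.1 ^ 2 + p.2.2 ^ 2| := by positivity
  rw [enorm_mul, mul_pow, one_mul, ← add_assoc]
  congr 1
  rw [← ofReal_norm, ← ENNReal.ofReal_pow (norm_nonneg _), Complex.norm_real,
    Real.norm_of_nonneg (by positivity), ← Real.rpow_natCast, ← Real.rpow_mul hpos.le]
  norm_num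

lemma hasDecay_schwartz (F : 𝓢(ℝ × ℝ × ℝ, ℂ)) : HasDecay (fun t x y => F (t, x, y)) where
  meas := F.continuous.measurable
  bound := by
    set B : ℝ := 2 ^ 6 * ((Finset.Iic ((6, 0) : ℕ × ℕ)).sup
      fun m => SchwartzMap.seminorm ℝ m.1 m.2) F with hB
    have hbound : ∀ q, (1 + ‖q‖) ^ 6 * ‖F q‖ ≤ B := fun q => by
      have h := SchwartzMap.one_add_le_sup_seminorm_apply (𝕜 := ℝ) (m := (6, 0)) (k := 6) (n := 0)
        le_rfl le_rfl F q
      rwa [norm_iteratedFDeriv_zero] at h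
    have hB0 : 0 ≤ B := (by positivity : (0 : ℝ) ≤ (1 + ‖(0 : ℝ × ℝ × ℝ)‖) ^ 6 * ‖F 0‖).trans
      (hbound 0)
    refine ⟨B, hB0, fun t x y => ?_⟩
    have hb := hbound (t, x, y)
    set m := ‖(t, x, y)‖ with hm
    have hcoord : ∀ s : ℝ, |s| ≤ m → 1 + s ^ 2 ≤ (1 + m) ^ 2 := fun s hs => by
      rw [← sq_abs]
      nlinarith [abs_nonneg s]
    have ht := hcoord t (by rw [hm, ← Real.norm_eq_abs]; exact norm_fst_le (t, x, y))
    have hx := hcoord x (by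
      rw [hm, ← Real.norm_eq_abs]; exact (norm_fst_le (x, y)).trans (norm_snd_le (t, x, y)))
    have hy := hcoord y (by
      rw [hm, ← Real.norm_eq_abs]; exact (norm_snd_le (x, y)).trans (norm_snd_le (t, x, y)))
    unfold quadDecay
    rw [← mul_inv, ← mul_inv, ← div_eq_mul_inv, le_div_iff₀ (by positivity), mul_comm]
    calc (1 + t ^ 2) * (1 + x ^ 2) * (1 + y ^ 2) * ‖F (t, x, y)‖
        ≤ (1 + m) ^ 2 * (1 + m) ^ 2 * (1 + m) ^ 2 * ‖F (t, x, y)‖ := by gcongr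
      _ = (1 + m) ^ 6 * ‖F (t, x, y)‖ := by ring
      _ ≤ B := hb

/-- The change of variables `(x - y, x + y) ↦ (x, y)`. -/
def rotatePlane : (ℝ × ℝ) ≃ₗ[ℝ] (ℝ × ℝ) where
  toFun z := ((z.2 + z.1) / 2, (z.2 - z.1) / 2)
  invFun q := (q.1 - q.2, q.1 + q.2)
  map_add' a b := by ext <;> simp <;> ring
  map_smul' a b := by ext <;> simp <;> ring
  left_inv a := by ext <;> simp <;> ring
  right_inv a := by ext <;> simp

/-- The change of frequencies dual to `rotatePlane`. -/
def rotateFreq : (ℝ × ℝ) ≃ₗ[ℝ] (ℝ × ℝ) where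
  toFun q := ((q.1 - q.2) / 2, (q.1 + q.2) / 2)
  invFun z := (z.1 + z.2, z.2 - z.1)
  map_add' a b := by ext <;> simp <;> ring
  map_smul' a b := by ext <;> simp <;> ring
  left_inv a := by ext <;> simp <;> ring
  right_inv a := by ext <;> simp <;> ring

lemma map_volume_linearEquiv (L : (ℝ × ℝ) ≃ₗ[ℝ] (ℝ × ℝ)) :
    ∃ c : ℝ, 0 < c ∧ (volume : Measure (ℝ × ℝ)).map L = ENNReal.ofReal c • volume := by
  have hdet : LinearMap.det (L : (ℝ × ℝ) →ₗ[ℝ] (ℝ × ℝ)) ≠ 0 := L.isUnit_det'.ne_zero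
  refine ⟨|(LinearMap.det (L : (ℝ × ℝ) →ₗ[ℝ] (ℝ × ℝ)))⁻¹|, abs_pos.2 (inv_ne_zero hdet), ?_⟩
  exact Measure.map_linearMap_addHaar_eq_smul_addHaar volume hdet

lemma HasDecay.FTtxy_eq_integral_plane {f : ℝ → ℝ → ℝ → ℂ} (hf : HasDecay f) (τ ξ η : ℝ) :
    FTtxy f τ ξ η = ∫ t : ℝ, ∫ q : ℝ × ℝ,
      cexp (-I * ((τ * t + ξ * q.1 + η * q.2 : ℝ) : ℂ)) * f t q.1 q.2 := by
  obtain ⟨A, -, hA⟩ := hf.bound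
  unfold FTtxy
  congr 1; ext t
  rw [Measure.volume_eq_prod, integral_prod]
  · push_cast
    rfl
  · have hm : Measurable (fun q : ℝ × ℝ => f t q.1 q.2) :=
      hf.meas.comp (f := fun q : ℝ × ℝ => (t, q)) (by fun_prop)
    have hi : Integrable (fun q : ℝ × ℝ => f t q.1 q.2) (volume.prod volume) :=
      ((integrable_quadDecay.mul_prod integrable_quadDecay).const_mul (A * quadDecay t)).mono'
        hm.aestronglyMeasurable (ae_of_all _ fun q => (hA t q.1 q.2).trans_eq (by ring))
    exact hi.bdd_mul (c := 1) (by fun_prop) (ae_of_all _ fun q => (norm_exp_neg_I_mul _).le)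

/-- Passing to the variables `(x - y, x + y)` turns the paraboloid `τ + ξ² + η² = 0` into
`τ + 2(ξ² + η²) = 0`. -/
lemma bourgainEnergy_rotatePlane :
    ∃ c : ℝ≥0, ∀ f : ℝ → ℝ → ℝ → ℂ, HasDecay f →
      HasDecay (fun t u w => f t ((w + u) / 2) ((w - u) / 2)) →
      bourgainEnergy 1 f ≤ c * bourgainEnergy 2 (fun t u w => f t ((w + u) / 2) ((w - u) / 2)) := by
  obtain ⟨a, ha, hplane⟩ := map_volume_linearEquiv rotatePlane
  obtain ⟨b, hb, hfreq⟩ := map_volume_linearEquiv rotateFreq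
  refine ⟨(Real.toNNReal a⁻¹) ^ 2 * Real.toNNReal b, fun f hf hg => ?_⟩
  set g : ℝ → ℝ → ℝ → ℂ := fun t u w => f t ((w + u) / 2) ((w - u) / 2) with hgdef
  have hFT : ∀ τ (q : ℝ × ℝ), FTtxy g τ (rotateFreq q).1 (rotateFreq q).2
      = (a : ℂ) * FTtxy f τ q.1 q.2 := by
    intro τ q
    rw [hf.FTtxy_eq_integral_plane, hg.FTtxy_eq_integral_plane, ← integral_const_mul]
    congr 1; ext t
    have hemb : MeasurableEmbedding rotatePlane :=
      rotatePlane.toContinuousLinearEquiv.toHomeomorph.measurableEmbedding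
    have h := hemb.integral_map (μ := volume) fun z : ℝ × ℝ =>
      cexp (-I * ((τ * t + q.1 * z.1 + q.2 * z.2 : ℝ) : ℂ)) * f t z.1 z.2
    rw [hplane, integral_smul_measure, ENNReal.toReal_ofReal ha.le] at h
    rw [← Complex.real_smul, h]
    congr 1; ext z
    have e : τ * t + (rotateFreq q).1 * z.1 + (rotateFreq q).2 * z.2
        = τ * t + q.1 * (rotatePlane z).1 + q.2 * (rotatePlane z).2 := by
      simp only [rotateFreq, rotatePlane, LinearEquiv.coe_mk, LinearMap.coe_mk, AddHom.coe_mk]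
      ring
    rw [e]
    rfl
  have hFT' : ∀ τ (q : ℝ × ℝ), ‖FTtxy f τ q.1 q.2‖ₑ
      = ENNReal.ofReal a⁻¹ * ‖FTtxy g τ (rotateFreq q).1 (rotateFreq q).2‖ₑ := by
    intro τ q
    rw [hFT, enorm_mul, ← ofReal_norm (a : ℂ), Complex.norm_real, Real.norm_of_nonneg ha.le,
      ← mul_assoc, ← ENNReal.ofReal_mul (by positivity), inv_mul_cancel₀ ha.ne']
    simp
  set W : ℝ × ℝ × ℝ → ℝ≥0∞ := fun p =>
    ENNReal.ofReal ((1 + |p.1 + 2 * (p.2.1 ^ 2 + p.2.2 ^ 2)|) ^ (-(7 / 8) : ℝ)) *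
      ‖FTtxy g p.1 p.2.1 p.2.2‖ₑ ^ 2 with hW
  have hWm : Measurable W :=
    Measurable.mul (by fun_prop) (hg.measurable_FTtxy.enorm.pow_const 2)
  have hL : Measurable rotateFreq := rotateFreq.toContinuousLinearEquiv.continuous.measurable
  have hpt : ∀ p : ℝ × ℝ × ℝ,
      ENNReal.ofReal ((1 + |p.1 + 1 * (p.2.1 ^ 2 + p.2.2 ^ 2)|) ^ (-(7 / 8) : ℝ)) *
        ‖FTtxy f p.1 p.2.1 p.2.2‖ₑ ^ 2 = ENNReal.ofReal a⁻¹ ^ 2 * W (p.1, rotateFreq p.2) := by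
    intro p
    have e : 2 * ((rotateFreq p.2).1 ^ 2 + (rotateFreq p.2).2 ^ 2)
        = 1 * (p.2.1 ^ 2 + p.2.2 ^ 2) := by
      simp only [rotateFreq, LinearEquiv.coe_mk, LinearMap.coe_mk, AddHom.coe_mk]
      ring
    simp only [hW, e, hFT']
    ring
  have hinner : ∀ τ, ∫⁻ q : ℝ × ℝ, W (τ, rotateFreq q)
      = ENNReal.ofReal b * ∫⁻ q : ℝ × ℝ, W (τ, q) := by
    intro τ
    rw [← lintegral_map (f := fun q => W (τ, q))
      (hWm.comp (f := fun q : ℝ × ℝ => (τ, q)) (by fun_prop)) hL, hfreq, lintegral_smul_measure,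
      smul_eq_mul]
  refine le_of_eq ?_
  calc bourgainEnergy 1 f = ∫⁻ p : ℝ × ℝ × ℝ, ENNReal.ofReal a⁻¹ ^ 2 * W (p.1, rotateFreq p.2) :=
        lintegral_congr hpt
    _ = ENNReal.ofReal a⁻¹ ^ 2 * ∫⁻ τ, ∫⁻ q : ℝ × ℝ, W (τ, rotateFreq q) := by
        rw [lintegral_const_mul' _ _ (by finiteness), Measure.volume_eq_prod, lintegral_prod]
        exact (hWm.comp (f := fun p : ℝ × ℝ × ℝ => (p.1, rotateFreq p.2))
          (measurable_fst.prodMk (hL.comp measurable_snd))).aemeasurable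
    _ = ENNReal.ofReal a⁻¹ ^ 2 * (ENNReal.ofReal b * ∫⁻ p, W p) := by
        simp_rw [hinner]
        rw [lintegral_const_mul' _ _ (by finiteness), Measure.volume_eq_prod ℝ (ℝ × ℝ),
          lintegral_prod _ hWm.aemeasurable]
    _ = _ := by
        rw [ENNReal.coe_mul, ENNReal.coe_pow, mul_assoc]
        rfl

lemma sqrt_le_of_le_const_mul {E K D : ℝ≥0∞} (hK : K ≠ ⊤) {T : ℝ} (hT : 0 < T)
    (h : E ≤ K * (ENNReal.ofReal (T ^ (1 / 4 : ℝ)) * D)) :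
    E ^ (1 / 2 : ℝ) ≤ ENNReal.ofReal (((K ^ (1 / 2 : ℝ)).toReal + 1) * T ^ (1 / 8 : ℝ)) *
      D ^ (1 / 2 : ℝ) := by
  have hK' : K ^ (1 / 2 : ℝ) ≠ ⊤ := ENNReal.rpow_ne_top_of_nonneg (by norm_num) hK
  calc E ^ (1 / 2 : ℝ) ≤ (K * (ENNReal.ofReal (T ^ (1 / 4 : ℝ)) * D)) ^ (1 / 2 : ℝ) :=
        ENNReal.rpow_le_rpow h (by norm_num)
    _ = K ^ (1 / 2 : ℝ) * ENNReal.ofReal (T ^ (1 / 8 : ℝ)) * D ^ (1 / 2 : ℝ) := by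
        rw [ENNReal.mul_rpow_of_nonneg _ _ (by norm_num),
          ENNReal.mul_rpow_of_nonneg _ _ (by norm_num),
          ENNReal.ofReal_rpow_of_nonneg (by positivity) (by norm_num), ← Real.rpow_mul hT.le,
          mul_assoc]
        norm_num
    _ ≤ _ := by
        rw [ENNReal.ofReal_mul (by positivity)]
        gcongr
        calc K ^ (1 / 2 : ℝ) = ENNReal.ofReal (K ^ (1 / 2 : ℝ)).toReal :=
              (ENNReal.ofReal_toReal hK').symm
          _ ≤ _ := ENNReal.ofReal_le_ofReal (by linarith)

/-- Dual dispersive embedding into the Bourgain space `X^{−1/2+δ}`. -/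
theorem dual_dispersive_bourgain_embedding :
    ∃ p₀ : ℝ, 1 < p₀ ∧ ∀ p : ℝ, 1 < p → p ≤ p₀ →
      ∃ δ c C : ℝ, 0 < δ ∧ 0 < c ∧ 0 < C ∧ ∀ T : ℝ, 0 < T → T ≤ 1 →
        ∀ F : 𝓢(ℝ × ℝ × ℝ, ℂ),
          (∀ q : ℝ × ℝ × ℝ, F q ≠ 0 → 0 ≤ q.1 ∧ q.1 ≤ T) →
          XbNorm (-(1/2) + δ) (fun t x y => F (t, x, y))
              ≤ ENNReal.ofReal (C * T ^ c) *
                  MixedN3 volume 2 (ENNReal.ofReal p) 2 (fun t x y => F (t, x, y)) ∧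
          XbNorm (-(1/2) + δ) (fun t x y => F (t, x, y))
              ≤ ENNReal.ofReal (C * T ^ c) *
                  MixedN3 volume 2 (ENNReal.ofReal p) 2
                    (fun t u w => F (t, (w + u) / 2, (w - u) / 2)) := by
  obtain ⟨a, ha⟩ := bourgainEnergy_rotatePlane
  set K : ℝ≥0∞ := 4 * (ENNReal.ofReal (Real.exp 65536 * (16 * π)) * ENNReal.ofReal (2 * π) ^ 2)
    with hKdef
  have hK : K ≠ ⊤ := by rw [hKdef]; finiteness
  have hK' : (1 + a) * K ≠ ⊤ := by finiteness
  refine ⟨2, by norm_num, fun p hp hp2 => ⟨1 / 16, 1 / 8, (((1 + a) * K) ^ (1 / 2 : ℝ)).toReal + 1,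
    by norm_num, by norm_num, by positivity, fun T hT _ F hF => ?_⟩⟩
  have hsupp : ∀ t x y, t ∉ Set.Icc 0 T → F (t, x, y) = 0 := fun t x y ht => by
    by_contra hne
    exact ht (hF (t, x, y) hne)
  have hf := hasDecay_schwartz F
  have hg : HasDecay (fun t u w => F (t, (w + u) / 2, (w - u) / 2)) :=
    hasDecay_schwartz (SchwartzMap.compCLMOfContinuousLinearEquiv ℝ
      ((LinearEquiv.refl ℝ ℝ).prodCongr rotatePlane).toContinuousLinearEquiv F)
  rw [XbNorm_eq, hf.MixedN3_eq hp, hg.MixedN3_eq hp]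
  constructor
  · refine sqrt_le_of_le_const_mul hK' hT
      ((hf.bourgainEnergy_le_mixed hp hp2 hT le_rfl hsupp).trans ?_)
    exact mul_le_mul_left (le_mul_of_one_le_left (zero_le (a := K)) le_self_add) _
  · refine sqrt_le_of_le_const_mul hK' hT ((ha _ hf hg).trans ?_)
    rw [mul_assoc]
    gcongr
    · exact le_add_self
    · exact hg.bourgainEnergy_le_mixed hp hp2 hT (by norm_num) fun t u w ht => hsupp _ _ _ ht

end
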